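/- arXiv:2312.15935 — 3 statements merged into one kernel-verified Lean document; each statement's English description precedes it below -/
import Mathlib

section
/- Characterization of relative compactness: let d_m be a distance on ℳ≤1(Z) inducing the weak topology on ℳ≤1(Z) and such that the cut distance d_{□,m} on 𝒲₁ is smooth and weakly regular. Then (i) every sequence of probability-graphons converging for δ_{□,m} is tight; and (ii) a subset K of the quotient space 𝒲̃₁ of probability-graphons modulo weak isomorphism is relatively compact for δ_{□,m} if and only if K is tight. -/
open MeasureTheory Filter Topology
open scoped ENNReal NNReal

noncomputable section

namespace PG

/-- The unit square `[0,1]²`, with its product Lebesgue measure. -/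
abbrev Sq : Type := unitInterval × unitInterval

variable {Z : Type*} [MeasurableSpace Z] [TopologicalSpace Z]

/-! ### Measure-valued kernels and probability-graphons -/

/-- `W(A;·) = ∫_A W(x,y;·) dx dy` for a measure-valued kernel. -/
def kernelInt (W : Sq → Measure Z) (A : Set Sq) : Measure Z :=
  ((volume : Measure Sq).restrict A).bind W

/-- The measure `M_W = W([0,1]²;·)` associated with a (positive) measure-valued kernel. -/
def MW (W : Sq → Measure Z) : Measure Z := (volume : Measure Sq).bind W

/-- A probability-graphon: a measurable map from `[0,1]²` to probability measures on `Z`. -/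
def IsProbGraphon (W : Sq → Measure Z) : Prop :=
  (∀ A : Set Z, MeasurableSet A → Measurable fun p => W p A) ∧
    ∀ p, IsProbabilityMeasure (W p)

/-- Essential supremum of the total mass of a positive measure-valued kernel. -/
def TVboundPos (W : Sq → Measure Z) : ℝ≥0∞ :=
  essSup (fun p => W p Set.univ) (volume : Measure Sq)

/-- A (positive) measure-valued kernel: measurable and essentially bounded. -/
def IsPosKernel (W : Sq → Measure Z) : Prop :=
  (∀ A : Set Z, MeasurableSet A → Measurable fun p => W p A) ∧ TVboundPos W < ⊤

/-- Relabeling `W^φ` of a kernel by a map `φ : [0,1] → [0,1]`. -/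
def relabel (W : Sq → Measure Z) (φ : unitInterval → unitInterval) : Sq → Measure Z :=
  fun p => W (φ p.1, φ p.2)

/-- `φ` is a Lebesgue-measure-preserving map of `[0,1]`. -/
def IsMP (φ : unitInterval → unitInterval) : Prop :=
  MeasurePreserving φ (volume : Measure unitInterval) (volume : Measure unitInterval)

/-- Weak convergence of a sequence of (finite) measures on `Z`. -/
def WeakTendsto (μ : ℕ → Measure Z) (ν : Measure Z) : Prop :=
  ∀ f : BoundedContinuousFunction Z ℝ,
    Tendsto (fun n => ∫ x, f x ∂(μ n)) atTop (𝓝 (∫ x, f x ∂ν))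

/-- The cut distance `d_{□,m}` associated with a distance `d_m` on measures. -/
def cutDist (dm : Measure Z → Measure Z → ℝ) (U W : Sq → Measure Z) : ℝ :=
  ⨆ ST : {p : Set unitInterval × Set unitInterval // MeasurableSet p.1 ∧ MeasurableSet p.2},
    dm (kernelInt U (ST.val.1 ×ˢ ST.val.2)) (kernelInt W (ST.val.1 ×ˢ ST.val.2))

/-- The unlabeled cut distance `δ_□` associated with a distance `d` on kernels:
`δ_□(U,W) = inf_{φ ∈ S_{[0,1]}} d(U, W^φ)`. -/
def deltaCut (d : (Sq → Measure Z) → (Sq → Measure Z) → ℝ) (U W : Sq → Measure Z) : ℝ :=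
  ⨅ φ : {φ : unitInterval → unitInterval // IsMP φ ∧ Function.Bijective φ},
    d U (relabel W φ.val)

/-- Weak isomorphism of kernels: `U^φ = W^ψ` a.e. for some measure-preserving `φ, ψ`. -/
def WeakIso (U W : Sq → Measure Z) : Prop :=
  ∃ φ ψ : unitInterval → unitInterval, IsMP φ ∧ IsMP ψ ∧
    relabel U φ =ᵐ[(volume : Measure Sq)] relabel W ψ

/-- A family of kernels is tight if the family of measures `{M_W}` is tight. -/
def TightFamily (K : Set (Sq → Measure Z)) : Prop :=
  ∀ ε : ℝ≥0∞, 0 < ε → ∃ K₀ : Set Z, IsCompact K₀ ∧ ∀ W ∈ K, MW W K₀ᶜ ≤ ε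

/-- Invariance of a distance on probability-graphons under bijective
measure-preserving relabelings. -/
def Invariant (d : (Sq → Measure Z) → (Sq → Measure Z) → ℝ) : Prop :=
  ∀ U W : Sq → Measure Z, IsProbGraphon U → IsProbGraphon W →
    ∀ φ : unitInterval → unitInterval, IsMP φ → Function.Bijective φ →
      d (relabel U φ) (relabel W φ) = d U W

/-- Smoothness of a distance on probability-graphons: a.e. weak convergence implies
convergence in `d`. -/
def Smooth (d : (Sq → Measure Z) → (Sq → Measure Z) → ℝ) : Prop :=
  ∀ (Wn : ℕ → Sq → Measure Z) (W : Sq → Measure Z),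
    (∀ n, IsProbGraphon (Wn n)) → IsProbGraphon W →
    (∀ᵐ p ∂(volume : Measure Sq), WeakTendsto (fun n => Wn n p) (W p)) →
    Tendsto (fun n => d (Wn n) W) atTop (𝓝 0)

/-- `d` is a distance on the space `𝒲₁` of probability-graphons (where kernels that
agree a.e. are identified). -/
def IsGraphonDist (d : (Sq → Measure Z) → (Sq → Measure Z) → ℝ) : Prop :=
  (∀ U W, IsProbGraphon U → IsProbGraphon W → d U W = d W U) ∧
  (∀ U W, IsProbGraphon U → IsProbGraphon W → 0 ≤ d U W) ∧
  (∀ U V W, IsProbGraphon U → IsProbGraphon V → IsProbGraphon W → d U W ≤ d U V + d V W) ∧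
  (∀ U W, IsProbGraphon U → IsProbGraphon W →
    (d U W = 0 ↔ U =ᵐ[(volume : Measure Sq)] W))

/-- Distance axioms for `d` on a subset `M`. -/
def IsDistOnSet {α : Type*} (M : Set α) (d : α → α → ℝ) : Prop :=
  (∀ x ∈ M, ∀ y ∈ M, d x y = d y x) ∧
  (∀ x ∈ M, ∀ y ∈ M, 0 ≤ d x y) ∧
  (∀ x ∈ M, ∀ y ∈ M, ∀ z ∈ M, d x z ≤ d x y + d y z) ∧
  (∀ x ∈ M, ∀ y ∈ M, (d x y = 0 ↔ x = y))

/-- The set `ℳ≤1(Z)` of measures of total mass at most one. -/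
def SubProb (Z : Type*) [MeasurableSpace Z] : Set (Measure Z) := {μ | μ Set.univ ≤ 1}

/-- `d_m` is a distance on `ℳ≤1(Z)`. -/
def IsDistOnSubProb (dm : Measure Z → Measure Z → ℝ) : Prop :=
  IsDistOnSet (SubProb Z) dm

/-- `d_m` induces the weak topology on `ℳ≤1(Z)` (sequential formulation; the weak
topology on `ℳ≤1(Z)` is metrizable, so it is characterized by its convergent
sequences). -/
def InducesWeakTopologySub (dm : Measure Z → Measure Z → ℝ) : Prop :=
  ∀ (μn : ℕ → Measure Z) (μ : Measure Z), (∀ n, μn n ∈ SubProb Z) → μ ∈ SubProb Z →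
    (Tendsto (fun n => dm (μn n) μ) atTop (𝓝 0) ↔ WeakTendsto μn μ)

/-- Quasi-convexity of a distance on the convex set `ℳ₊(Z)` of finite measures. -/
def QuasiConvexPos (dm : Measure Z → Measure Z → ℝ) : Prop :=
  ∀ μ₁ μ₂ ν₁ ν₂ : Measure Z, IsFiniteMeasure μ₁ → IsFiniteMeasure μ₂ →
    IsFiniteMeasure ν₁ → IsFiniteMeasure ν₂ → ∀ a : ℝ≥0∞, a ≤ 1 →
    dm (a • μ₁ + (1 - a) • μ₂) (a • ν₁ + (1 - a) • ν₂) ≤ max (dm μ₁ ν₁) (dm μ₂ ν₂)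

/-! ### Finite partitions of `[0,1]` and the stepping operator -/

/-- A finite measurable partition of `[0,1]` (possibly with empty classes). -/
structure FinPartition : Type where
  n : ℕ
  part : Fin n → Set unitInterval
  measurableSet : ∀ i, MeasurableSet (part i)
  disjoint : ∀ i j, i ≠ j → Disjoint (part i) (part j)
  covers : (⋃ i, part i) = Set.univ

/-- `P` refines `Q`: every class of `P` is included in a class of `Q`. -/
def FinPartition.Refines (P Q : FinPartition) : Prop :=
  ∀ i, ∃ j, P.part i ⊆ Q.part j

/-- The stepping `W_𝒫` of a (positive) measure-valued kernel `W` with respect to a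
finite partition `𝒫`: on `S_i × S_j` it equals `W(S_i×S_j;·)/(λ(S_i)λ(S_j))`
(and the zero measure on classes of zero measure). -/
def stepping (W : Sq → Measure Z) (P : FinPartition) : Sq → Measure Z :=
  fun p => ∑ i : Fin P.n, ∑ j : Fin P.n,
    Set.indicator (P.part i ×ˢ P.part j)
      (fun _ => ((volume (P.part i)) * (volume (P.part j)))⁻¹ •
        kernelInt W (P.part i ×ˢ P.part j)) p

/-- Weak regularity of a distance on probability-graphons. -/
def WeaklyRegular (d : (Sq → Measure Z) → (Sq → Measure Z) → ℝ) : Prop :=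
  ∀ K : Set (Sq → Measure Z), (∀ W ∈ K, IsProbGraphon W) → TightFamily K →
    ∀ ε : ℝ, 0 < ε → ∃ m : ℕ, 0 < m ∧
      ∀ W ∈ K, ∀ Q : FinPartition, ∃ P : FinPartition,
        P.Refines Q ∧ P.n ≤ m * Q.n ∧ d W (stepping W P) < ε

/-- Regularity of a distance on probability-graphons with respect to the stepping
operator. -/
def SteppingRegular (d : (Sq → Measure Z) → (Sq → Measure Z) → ℝ) : Prop :=
  ∃ C₀ : ℝ, 0 < C₀ ∧ ∀ W U : Sq → Measure Z, IsProbGraphon W → IsProbGraphon U →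
    ∀ P : FinPartition, d W (stepping W P) ≤ C₀ * d W (stepping U P)

/-! ### Signed measure-valued kernels -/

/-- The signed measure associated with a finite measure (and junk value `0` on
non-finite measures). -/
def toSigned (μ : Measure Z) : SignedMeasure Z :=
  letI := Classical.dec (IsFiniteMeasure μ)
  if h : IsFiniteMeasure μ then @Measure.toSignedMeasure Z _ μ h else 0

/-- `W(A;·)` for a signed measure-valued kernel. -/
def skernelInt (W : Sq → SignedMeasure Z) (A : Set Sq) : SignedMeasure Z :=
  toSigned (((volume : Measure Sq).restrict A).bind
      fun p => (W p).toJordanDecomposition.posPart)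
    - toSigned (((volume : Measure Sq).restrict A).bind
      fun p => (W p).toJordanDecomposition.negPart)

/-- Total mass `‖s‖_TV` of the total variation of a signed measure. -/
def TVnorm (s : SignedMeasure Z) : ℝ≥0∞ := s.totalVariation Set.univ

/-- `‖W‖∞`, the essential supremum of the total variation masses of a signed
measure-valued kernel. -/
def TVbound (W : Sq → SignedMeasure Z) : ℝ≥0∞ :=
  essSup (fun p => TVnorm (W p)) (volume : Measure Sq)

/-- A signed measure-valued kernel: measurable in `(x,y)` and essentially bounded in
total variation. -/
def IsSignedKernel (W : Sq → SignedMeasure Z) : Prop :=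
  (∀ A : Set Z, MeasurableSet A → Measurable fun p => W p A) ∧ TVbound W < ⊤

/-- The measure `M_W = ∫ |W|(x,y;·) dx dy` of a signed measure-valued kernel. -/
def MWs (W : Sq → SignedMeasure Z) : Measure Z :=
  (volume : Measure Sq).bind fun p => (W p).totalVariation

/-- Tightness for a family of signed measure-valued kernels. -/
def TightFamilyS (K : Set (Sq → SignedMeasure Z)) : Prop :=
  ∀ ε : ℝ≥0∞, 0 < ε → ∃ K₀ : Set Z, IsCompact K₀ ∧ ∀ W ∈ K, MWs W K₀ᶜ ≤ ε

/-- Integral of a bounded continuous function against a signed measure. -/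
def sint (f : BoundedContinuousFunction Z ℝ) (s : SignedMeasure Z) : ℝ :=
  ∫ x, f x ∂s.toJordanDecomposition.posPart - ∫ x, f x ∂s.toJordanDecomposition.negPart

/-- Weak convergence of signed measures. -/
def WeakTendstoS (s : ℕ → SignedMeasure Z) (t : SignedMeasure Z) : Prop :=
  ∀ f : BoundedContinuousFunction Z ℝ,
    Tendsto (fun n => sint f (s n)) atTop (𝓝 (sint f t))

/-- Stepping of a signed measure-valued kernel with respect to a finite partition. -/
def steppingS (W : Sq → SignedMeasure Z) (P : FinPartition) : Sq → SignedMeasure Z :=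
  fun p => ∑ i : Fin P.n, ∑ j : Fin P.n,
    Set.indicator (P.part i ×ˢ P.part j)
      (fun _ => (((volume (P.part i)).toReal * (volume (P.part j)).toReal)⁻¹ : ℝ) •
        skernelInt W (P.part i ×ˢ P.part j)) p

/-- Cut distance for signed measure-valued kernels associated with a distance `d_m`
on signed measures. -/
def cutDistS (dm : SignedMeasure Z → SignedMeasure Z → ℝ) (U W : Sq → SignedMeasure Z) : ℝ :=
  ⨆ ST : {p : Set unitInterval × Set unitInterval // MeasurableSet p.1 ∧ MeasurableSet p.2},
    dm (skernelInt U (ST.val.1 ×ˢ ST.val.2)) (skernelInt W (ST.val.1 ×ˢ ST.val.2))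

/-- Quasi-convexity of a distance on a convex subset `M` of signed measures. -/
def QuasiConvexOn (M : Set (SignedMeasure Z)) (dm : SignedMeasure Z → SignedMeasure Z → ℝ) :
    Prop :=
  ∀ x₁ ∈ M, ∀ x₂ ∈ M, ∀ y₁ ∈ M, ∀ y₂ ∈ M, ∀ a : ℝ, 0 ≤ a → a ≤ 1 →
    dm (a • x₁ + (1 - a) • x₂) (a • y₁ + (1 - a) • y₂) ≤ max (dm x₁ y₁) (dm x₂ y₂)

/-! ### Convergence determining sequences and the associated norms -/

/-- `F` is a convergence determining sequence: `[0,1]`-valued bounded continuous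
functions, `F 0 = 1`, such that convergence of all moments `μ(f_k)` implies weak
convergence (for finite positive measures). -/
def IsConvDet (F : ℕ → BoundedContinuousFunction Z ℝ) : Prop :=
  F 0 = 1 ∧ (∀ k x, F k x ∈ Set.Icc (0:ℝ) 1) ∧
  ∀ (μn : ℕ → Measure Z) (μ : Measure Z), (∀ n, IsFiniteMeasure (μn n)) → IsFiniteMeasure μ →
    (∀ k, Tendsto (fun n => ∫ x, F k x ∂(μn n)) atTop (𝓝 (∫ x, F k x ∂μ))) →
    WeakTendsto μn μ

/-- `‖μ − ν‖_F = Σ_k 2^{-k} |μ(f_k) − ν(f_k)|` for positive measures. -/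
def Fdist (F : ℕ → BoundedContinuousFunction Z ℝ) (μ ν : Measure Z) : ℝ :=
  ∑' k : ℕ, (1/2 : ℝ) ^ k * |∫ x, F k x ∂μ - ∫ x, F k x ∂ν|

/-- The cut distance `d_{□,F}(U,W) = ‖U − W‖_{□,F}` on measure-valued kernels. -/
def cutDistF (F : ℕ → BoundedContinuousFunction Z ℝ) (U W : Sq → Measure Z) : ℝ :=
  ⨆ ST : {p : Set unitInterval × Set unitInterval // MeasurableSet p.1 ∧ MeasurableSet p.2},
    Fdist F (kernelInt U (ST.val.1 ×ˢ ST.val.2)) (kernelInt W (ST.val.1 ×ˢ ST.val.2))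

/-- The norm `‖s‖_F` of a signed measure. -/
def FnormS (F : ℕ → BoundedContinuousFunction Z ℝ) (s : SignedMeasure Z) : ℝ :=
  ∑' k : ℕ, (1/2 : ℝ) ^ k * |sint (F k) s|

/-- The cut norm `‖W‖_{□,F}` of a signed measure-valued kernel. -/
def cutNormFS (F : ℕ → BoundedContinuousFunction Z ℝ) (W : Sq → SignedMeasure Z) : ℝ :=
  ⨆ ST : {p : Set unitInterval × Set unitInterval // MeasurableSet p.1 ∧ MeasurableSet p.2},
    FnormS F (skernelInt W (ST.val.1 ×ˢ ST.val.2))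

/-- The norm `‖W‖_{2,F}` of a signed measure-valued kernel. -/
def norm2F (F : ℕ → BoundedContinuousFunction Z ℝ) (W : Sq → SignedMeasure Z) : ℝ :=
  Real.sqrt (∑' k : ℕ, (1/2 : ℝ) ^ k * ∫ p, (sint (F k) (W p)) ^ 2 ∂(volume : Measure Sq))

/-! ### Homomorphism densities and sampling -/

/-- The homomorphism density `t(F^g, W)` of a `C_b(Z)`-decorated finite directed graph
with vertex set `Fin v` and edge set `E` in a measure-valued kernel `W`. -/
def homDensity {v : ℕ} (E : Finset (Fin v × Fin v))
    (g : Fin v × Fin v → BoundedContinuousFunction Z ℝ) (W : Sq → Measure Z) : ℝ :=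
  ∫ x : Fin v → unitInterval,
    (∏ e ∈ E, ∫ z, g e z ∂(W (x e.1, x e.2))) ∂(volume : Measure (Fin v → unitInterval))

/-- The edge set of the complete directed graph on `k` vertices. -/
def completeEdges (k : ℕ) : Finset (Fin k × Fin k) :=
  Finset.univ.filter fun e => e.1 ≠ e.2

/-- The `i`-th step `((i)/k, (i+1)/k]` of the uniform partition of `[0,1]` into `k`
intervals. -/
def stepSet (k : ℕ) (i : Fin k) : Set unitInterval :=
  {t | (i : ℝ) / k < (t : ℝ) ∧ (t : ℝ) ≤ ((i : ℝ) + 1) / k}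

/-- The stepfunction `W_x` sampled from `W` at the points `x = (x₁, …, x_k)`. -/
def sample (W : Sq → Measure Z) {k : ℕ} (x : Fin k → unitInterval) : Sq → Measure Z :=
  fun p => ∑ i : Fin k, ∑ j : Fin k,
    Set.indicator (stepSet k i ×ˢ stepSet k j) (fun _ => W (x i, x j)) p

/-- The probability-graphon associated with the `Z`-weighted complete graph on `k`
vertices with weights `β`. -/
def graphonOfWeights {k : ℕ} (β : Fin k × Fin k → Z) : Sq → Measure Z :=
  fun p => ∑ i : Fin k, ∑ j : Fin k,
    Set.indicator (stepSet k i ×ˢ stepSet k j) (fun _ => Measure.dirac (β (i, j))) p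

/-- The joint law of `(X, (β_{ij}))` where `X` is uniform on `[0,1]^k` and, given `X`,
the weights `β_{ij}` are independent with respective laws `W(X_i, X_j;·)`. -/
def sampleLaw (W : Sq → Measure Z) (k : ℕ) :
    Measure ((Fin k → unitInterval) × (Fin k × Fin k → Z)) :=
  (volume : Measure (Fin k → unitInterval)).bind fun x =>
    (Measure.pi fun e : Fin k × Fin k => W (x e.1, x e.2)).map (Prod.mk x)


/-- A measurable kernel with values in the measures of mass at most one, seen as a `Kernel`. -/
def toKernel {Z : Type*} [MeasurableSpace Z] (W : Sq → Measure Z) (hW : Measurable W) :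
    ProbabilityTheory.Kernel Sq Z := ⟨W, hW⟩

/-- A measurable kernel with values in the measures of mass at most one. -/
structure IsSubKernel {Z : Type*} [MeasurableSpace Z] (W : Sq → Measure Z) : Prop where
  meas : Measurable W
  mass : ∀ p, W p Set.univ ≤ 1

theorem IsProbGraphon.isSubKernel {Z : Type*} [MeasurableSpace Z] {W : Sq → Measure Z}
    (hW : IsProbGraphon W) : IsSubKernel W :=
  ⟨Measure.measurable_of_measurable_coe _ hW.1, fun p => by
    have := hW.2 p
    exact prob_le_one⟩

theorem IsSubKernel.isFiniteKernel {Z : Type*} [MeasurableSpace Z] {W : Sq → Measure Z}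
    (hW : IsSubKernel W) : ProbabilityTheory.IsFiniteKernel (toKernel W hW.meas) :=
  ⟨1, by simp, hW.mass⟩

theorem IsSubKernel.isFiniteMeasure {Z : Type*} [MeasurableSpace Z] {W : Sq → Measure Z}
    (hW : IsSubKernel W) (p : Sq) : IsFiniteMeasure (W p) :=
  ⟨(hW.mass p).trans_lt (by simp)⟩

theorem kernelInt_apply {Z : Type*} [MeasurableSpace Z] {W : Sq → Measure Z}
    (hW : Measurable W) (A : Set Sq) {B : Set Z} (hB : MeasurableSet B) :
    kernelInt W A B = ∫⁻ p in A, W p B :=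
  Measure.bind_apply hB hW.aemeasurable

theorem MW_eq_kernelInt {Z : Type*} [MeasurableSpace Z] (W : Sq → Measure Z) :
    MW W = kernelInt W Set.univ := by
  simp [MW, kernelInt]

theorem kernelInt_le_MW {Z : Type*} [MeasurableSpace Z] {W : Sq → Measure Z}
    (hW : Measurable W) (A : Set Sq) : kernelInt W A ≤ MW W := by
  rw [MW_eq_kernelInt]
  refine Measure.le_iff.2 fun B hB => ?_
  rw [kernelInt_apply hW _ hB, kernelInt_apply hW _ hB]
  exact lintegral_mono_set (Set.subset_univ _)

theorem IsSubKernel.kernelInt_univ_le {Z : Type*} [MeasurableSpace Z] {W : Sq → Measure Z}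
    (hW : IsSubKernel W) (A : Set Sq) : kernelInt W A Set.univ ≤ volume A := by
  rw [kernelInt_apply hW.meas _ MeasurableSet.univ]
  calc ∫⁻ p in A, W p Set.univ ≤ ∫⁻ _ in A, 1 := lintegral_mono hW.mass
    _ = volume A := by simp

theorem IsSubKernel.kernelInt_mem {Z : Type*} [MeasurableSpace Z] {W : Sq → Measure Z}
    (hW : IsSubKernel W) (A : Set Sq) : kernelInt W A ∈ SubProb Z :=
  (hW.kernelInt_univ_le A).trans prob_le_one

theorem isFiniteMeasure_of_mem_subProb {Z : Type*} [MeasurableSpace Z] {μ : Measure Z}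
    (h : μ ∈ SubProb Z) : IsFiniteMeasure μ :=
  ⟨lt_of_le_of_lt h (by simp)⟩

theorem IsProbGraphon.isProbabilityMeasure_MW {Z : Type*} [MeasurableSpace Z]
    {W : Sq → Measure Z} (hW : IsProbGraphon W) : IsProbabilityMeasure (MW W) := by
  refine ⟨?_⟩
  rw [MW_eq_kernelInt, kernelInt_apply hW.isSubKernel.meas _ MeasurableSet.univ]
  have : ∀ p, W p Set.univ = 1 := fun p => (hW.2 p).measure_univ
  simp [this]

theorem IsSubKernel.abs_integral_le {Z : Type*} [MeasurableSpace Z] [TopologicalSpace Z]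
    {W : Sq → Measure Z} (hW : IsSubKernel W)
    (f : BoundedContinuousFunction Z ℝ) (p : Sq) : |∫ x, f x ∂(W p)| ≤ ‖f‖ := by
  have := hW.isFiniteMeasure p
  have h := norm_integral_le_of_norm_le_const (μ := W p)
    (Eventually.of_forall fun x => f.norm_coe_le_norm x)
  have h1 : (W p).real Set.univ ≤ 1 := by
    have := ENNReal.toReal_mono (by simp) (hW.mass p)
    simpa [Measure.real] using this
  rw [Real.norm_eq_abs] at h
  nlinarith [norm_nonneg f]

theorem IsSubKernel.measurable_integral {Z : Type*} [MeasurableSpace Z] [TopologicalSpace Z]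
    [OpensMeasurableSpace Z] {W : Sq → Measure Z} (hW : IsSubKernel W)
    (f : BoundedContinuousFunction Z ℝ) : Measurable fun p => ∫ x, f x ∂(W p) := by
  have := hW.isFiniteKernel
  have h : StronglyMeasurable fun p => ∫ x, f x ∂(toKernel W hW.meas p) :=
    (f.continuous.stronglyMeasurable).integral_kernel
  exact h.measurable

theorem IsSubKernel.integrable_integral {Z : Type*} [MeasurableSpace Z] [TopologicalSpace Z]
    [OpensMeasurableSpace Z] {W : Sq → Measure Z} (hW : IsSubKernel W)
    (f : BoundedContinuousFunction Z ℝ) {ν : Measure Sq} [IsFiniteMeasure ν] :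
    Integrable (fun p => ∫ x, f x ∂(W p)) ν :=
  Integrable.of_bound (hW.measurable_integral f).aestronglyMeasurable ‖f‖
    (Eventually.of_forall fun p => hW.abs_integral_le f p)

theorem IsSubKernel.integral_kernelInt {Z : Type*} [MeasurableSpace Z] [TopologicalSpace Z]
    [OpensMeasurableSpace Z] {W : Sq → Measure Z} (hW : IsSubKernel W)
    (A : Set Sq) (f : BoundedContinuousFunction Z ℝ) :
    ∫ x, f x ∂(kernelInt W A) = ∫ p in A, ∫ x, f x ∂(W p) := by
  have := hW.isFiniteKernel
  have h : kernelInt W A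
      = (((volume : Measure Sq).restrict A).compProd (toKernel W hW.meas)).snd := by
    rw [Measure.snd_compProd]; rfl
  rw [h, Measure.snd, integral_map (by fun_prop) f.continuous.aestronglyMeasurable,
    Measure.integral_compProd]
  · rfl
  · exact Integrable.of_bound (f.continuous.measurable.comp measurable_snd).aestronglyMeasurable ‖f‖
      (Eventually.of_forall fun p => f.norm_coe_le_norm _)

theorem exists_subseq_tendsto_of_isTight {X : Type*} [MeasurableSpace X] [TopologicalSpace X]
    [PolishSpace X] [BorelSpace X] (P : ℕ → ProbabilityMeasure X)
    (h : IsTightMeasureSet (Set.range fun n => (P n : Measure X))) :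
    ∃ (g : ℕ → ℕ) (Q : ProbabilityMeasure X), StrictMono g ∧
      Tendsto (fun n => P (g n)) atTop (𝓝 Q) := by
  have hc : IsCompact (closure (Set.range P)) := by
    apply isCompact_closure_of_isTightMeasureSet
    refine h.subset ?_
    rintro _ ⟨_, ⟨n, rfl⟩, rfl⟩
    exact ⟨n, rfl⟩
  obtain ⟨Q, -, g, hg, hlim⟩ := hc.tendsto_subseq (fun n => subset_closure (Set.mem_range_self n))
  exact ⟨g, Q, hg, hlim⟩

/-- Measures of mass at most one that are dominated by a fixed finite measure form a
weakly sequentially relatively compact family. -/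
theorem exists_subseq_weakTendsto_of_le {Z : Type*} [MeasurableSpace Z] [TopologicalSpace Z]
    [PolishSpace Z] [BorelSpace Z] {ν : Measure Z} [IsFiniteMeasure ν] {μ : ℕ → Measure Z}
    (hle : ∀ n, μ n ≤ ν) (hμ : ∀ n, μ n ∈ SubProb Z) :
    ∃ (g : ℕ → ℕ) (μ' : Measure Z), StrictMono g ∧ μ' ∈ SubProb Z ∧
      WeakTendsto (fun n => μ (g n)) μ' := by
  have hfin : ∀ n, IsFiniteMeasure (μ n) := fun n => isFiniteMeasure_of_mem_subProb (hμ n)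
  let F : ℕ → FiniteMeasure Z := fun n => ⟨μ n, hfin n⟩
  have hmass : ∀ n, (F n).mass ∈ Set.Icc (0 : ℝ≥0) 1 := fun n => by
    refine ⟨zero_le, ?_⟩
    rw [← ENNReal.coe_le_coe, FiniteMeasure.ennreal_mass]
    exact_mod_cast hμ n
  obtain ⟨c, hc, g₁, hg₁, hlim₁⟩ := isCompact_Icc.tendsto_subseq hmass
  rcases eq_or_ne c 0 with rfl | hc0
  · refine ⟨g₁, 0, hg₁, by simp [SubProb], fun f => ?_⟩
    simp only [integral_zero_measure]
    refine squeeze_zero_norm (a := fun n => ‖f‖ * ((F (g₁ n)).mass : ℝ)) (fun n => ?_) ?_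
    · exact norm_integral_le_of_norm_le_const (Eventually.of_forall fun x => f.norm_coe_le_norm x)
    · have : Tendsto (fun n => ((F (g₁ n)).mass : ℝ)) atTop (𝓝 ((0 : ℝ≥0) : ℝ)) :=
        (NNReal.tendsto_coe).2 hlim₁
      simpa using this.const_mul ‖f‖
  · have hcpos : 0 < c := pos_iff_ne_zero.2 hc0
    have hev : ∀ᶠ n in atTop, c / 2 < (F (g₁ n)).mass :=
      hlim₁.eventually (lt_mem_nhds (half_lt_self hcpos))
    obtain ⟨N, hN⟩ := eventually_atTop.1 hev
    have hshift : StrictMono fun n => g₁ (n + N) := fun a b hab => hg₁ (by omega)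
    have hlarge : ∀ n, c / 2 < (F (g₁ (n + N))).mass := fun n => hN _ (by omega)
    have hne : ∀ n, F (g₁ (n + N)) ≠ 0 := fun n => by
      rw [← FiniteMeasure.mass_nonzero_iff]
      exact ((half_pos hcpos).trans (hlarge n)).ne'
    have hZ : Nonempty Z := by
      by_contra hemp
      rw [not_nonempty_iff] at hemp
      apply hne 0
      ext s hs
      simp [Set.eq_empty_of_isEmpty s]
    let P : ℕ → ProbabilityMeasure Z := fun n => (F (g₁ (n + N))).normalize
    have htight : IsTightMeasureSet (Set.range fun n => (P n : Measure Z)) := by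
      have h1 := isTightMeasureSet_singleton (μ := ν)
      rw [isTightMeasureSet_iff_exists_isCompact_measure_compl_le] at h1 ⊢
      intro ε hε
      have hc2 : ((c / 2 : ℝ≥0) : ℝ≥0∞) ≠ 0 := by
        simpa using hc0
      obtain ⟨K, hK, hKν⟩ := h1 ((c / 2 : ℝ≥0) * ε) (ENNReal.mul_pos hc2 hε.ne')
      refine ⟨K, hK, ?_⟩
      rintro _ ⟨n, rfl⟩
      have h2 : (P n : Measure Z) Kᶜ = ((F (g₁ (n + N))).mass : ℝ≥0∞)⁻¹ * μ (g₁ (n + N)) Kᶜ := by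
        simp only [P]
        rw [FiniteMeasure.toMeasure_normalize_eq_of_nonzero _ (hne n)]
        have hm : (F (g₁ (n + N))).mass ≠ 0 := ((half_pos hcpos).trans (hlarge n)).ne'
        rw [← ENNReal.coe_inv hm]
        rfl
      rw [h2]
      calc ((F (g₁ (n + N))).mass : ℝ≥0∞)⁻¹ * μ (g₁ (n + N)) Kᶜ
          ≤ ((c / 2 : ℝ≥0) : ℝ≥0∞)⁻¹ * ((c / 2 : ℝ≥0) * ε) := by
            gcongr
            · exact (hlarge n).le
            · exact (hle _ _).trans (hKν _ rfl)
        _ = ε := by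
            rw [← mul_assoc, ENNReal.inv_mul_cancel hc2 ENNReal.coe_ne_top, one_mul]
    obtain ⟨g₂, Q, hg₂, hlim₂⟩ := exists_subseq_tendsto_of_isTight P htight
    let G : FiniteMeasure Z := c • Q.toFiniteMeasure
    have hGm : G.mass = c := by
      have h1 : (Q.toFiniteMeasure) Set.univ = 1 := Q.mass_toFiniteMeasure
      have h2 : G Set.univ = c * (Q.toFiniteMeasure) Set.univ := by
        simp only [G, FiniteMeasure.smul_apply, smul_eq_mul]
      rw [FiniteMeasure.mass, h2, h1, mul_one]
    have hGn : G.normalize = Q := by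
      have hG0 : G ≠ 0 := by
        rw [← FiniteMeasure.mass_nonzero_iff, hGm]; exact hc0
      ext s hs
      rw [FiniteMeasure.toMeasure_normalize_eq_of_nonzero _ hG0, hGm]
      simp only [G, FiniteMeasure.toMeasure_smul]
      rw [smul_smul, inv_mul_cancel₀ hc0, one_smul]
      rfl
    have hlim : Tendsto (fun n => F (g₁ (g₂ n + N))) atTop (𝓝 G) := by
      apply FiniteMeasure.tendsto_of_tendsto_normalize_testAgainstNN_of_tendsto_mass
      · rw [hGn]; exact hlim₂
      · rw [hGm]
        exact hlim₁.comp ((tendsto_add_atTop_nat N).comp hg₂.tendsto_atTop)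
    refine ⟨fun n => g₁ (g₂ n + N), G, hshift.comp hg₂, ?_, ?_⟩
    · have : (G : Measure Z) Set.univ = c := by
        rw [← FiniteMeasure.ennreal_mass, hGm]
      simp only [SubProb, Set.mem_ofPred_eq, this]
      exact_mod_cast hc.2
    · exact (FiniteMeasure.tendsto_iff_forall_integral_tendsto).1 hlim

theorem cutDist_nonneg {Z : Type*} [MeasurableSpace Z] {dm : Measure Z → Measure Z → ℝ}
    (hdm : IsDistOnSubProb dm) {U W : Sq → Measure Z} (hU : IsSubKernel U) (hW : IsSubKernel W) :
    0 ≤ cutDist dm U W :=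
  Real.iSup_nonneg fun _ => hdm.2.1 _ (hU.kernelInt_mem _) _ (hW.kernelInt_mem _)

theorem tendsto_dm_of_tendsto_integral_sub {Z : Type*} [MeasurableSpace Z] [TopologicalSpace Z]
    [PolishSpace Z] [BorelSpace Z] {dm : Measure Z → Measure Z → ℝ}
    (hdm : IsDistOnSubProb dm) (hweak : InducesWeakTopologySub dm)
    {κ : Measure Z} [IsFiniteMeasure κ] {μ ν : ℕ → Measure Z} (hle : ∀ n, μ n ≤ κ)
    (hμ : ∀ n, μ n ∈ SubProb Z) (hν : ∀ n, ν n ∈ SubProb Z)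
    (h : ∀ f : BoundedContinuousFunction Z ℝ,
      Tendsto (fun n => ∫ x, f x ∂(μ n) - ∫ x, f x ∂(ν n)) atTop (𝓝 0)) :
    Tendsto (fun n => dm (μ n) (ν n)) atTop (𝓝 0) := by
  refine tendsto_of_subseq_tendsto fun ns hns => ?_
  obtain ⟨g, μ', hgm, hμ', hlim⟩ := exists_subseq_weakTendsto_of_le (fun n => hle (ns n))
    (fun n => hμ (ns n))
  refine ⟨fun n => g n, ?_⟩
  have hg : Tendsto g atTop atTop := hgm.tendsto_atTop
  have h1 : Tendsto (fun n => dm (μ (ns (g n))) μ') atTop (𝓝 0) :=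
    (hweak _ _ (fun n => hμ _) hμ').2 hlim
  have h2 : Tendsto (fun n => dm (ν (ns (g n))) μ') atTop (𝓝 0) := by
    refine (hweak _ _ (fun n => hν _) hμ').2 fun f => ?_
    have h3 := (hlim f).sub (((h f).comp hns).comp hg)
    simpa using h3
  refine squeeze_zero (fun n => hdm.2.1 _ (hμ _) _ (hν _)) (fun n => ?_) (by simpa using h1.add h2)
  rw [hdm.1 (ν (ns (g n))) (hν _) μ' hμ']
  exact hdm.2.2.1 _ (hμ _) _ hμ' _ (hν _)

theorem bddAbove_range_dm {Z : Type*} [MeasurableSpace Z] [TopologicalSpace Z]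
    [PolishSpace Z] [BorelSpace Z] {dm : Measure Z → Measure Z → ℝ}
    (hdm : IsDistOnSubProb dm) (hweak : InducesWeakTopologySub dm)
    {U W : Sq → Measure Z} (hU : IsSubKernel U) (hW : IsSubKernel W) :
    BddAbove (Set.range fun A : Set Sq => dm (kernelInt U A) (kernelInt W A)) := by
  have key : ∀ V : Sq → Measure Z, IsSubKernel V →
      BddAbove (Set.range fun A : Set Sq => dm (kernelInt V A) 0) := by
    intro V hV
    by_contra hb
    rw [not_bddAbove_iff] at hb
    have h1 : ∀ n : ℕ, ∃ B, (n : ℝ) < dm (kernelInt V B) 0 := fun n => by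
      obtain ⟨_, ⟨B, rfl⟩, h⟩ := hb n
      exact ⟨B, h⟩
    choose B hB using h1
    have hfin : IsFiniteMeasure (MW V) := by
      rw [MW_eq_kernelInt]; exact isFiniteMeasure_of_mem_subProb (hV.kernelInt_mem _)
    obtain ⟨g, μ', hg, hμ', hlim⟩ := exists_subseq_weakTendsto_of_le
      (fun n => kernelInt_le_MW hV.meas (B n)) (fun n => hV.kernelInt_mem (B n))
    have h2 := (hweak _ _ (fun n => hV.kernelInt_mem _) hμ').2 hlim
    have h3 := h2.eventually (gt_mem_nhds one_pos)
    obtain ⟨N, hN⟩ := eventually_atTop.1 h3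
    have h0 : (0 : Measure Z) ∈ SubProb Z := by simp [SubProb]
    obtain ⟨n, hn⟩ := exists_nat_gt (1 + dm μ' 0)
    have h4 := hdm.2.2.1 _ (hV.kernelInt_mem (B (g (max n N)))) _ hμ' _ h0
    have h5 := hN (max n N) (le_max_right _ _)
    have h6 := hB (g (max n N))
    have h7 : (n : ℝ) ≤ (g (max n N) : ℝ) := by
      exact_mod_cast (le_max_left n N).trans (hg.id_le _)
    linarith
  obtain ⟨a, ha⟩ := key U hU
  obtain ⟨b, hb⟩ := key W hW
  refine ⟨a + b, ?_⟩
  rintro _ ⟨A, rfl⟩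
  have h0 : (0 : Measure Z) ∈ SubProb Z := by simp [SubProb]
  have h1 := ha ⟨A, rfl⟩
  have h2 := hb ⟨A, rfl⟩
  have h3 := hdm.2.2.1 _ (hU.kernelInt_mem A) _ h0 _ (hW.kernelInt_mem A)
  rw [hdm.1 0 h0 _ (hW.kernelInt_mem A)] at h3
  simp only at h1 h2 ⊢
  linarith

theorem dm_le_cutDist {Z : Type*} [MeasurableSpace Z] [TopologicalSpace Z]
    [PolishSpace Z] [BorelSpace Z] {dm : Measure Z → Measure Z → ℝ}
    (hdm : IsDistOnSubProb dm) (hweak : InducesWeakTopologySub dm)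
    {U W : Sq → Measure Z} (hU : IsSubKernel U) (hW : IsSubKernel W)
    {S T : Set unitInterval} (hS : MeasurableSet S) (hT : MeasurableSet T) :
    dm (kernelInt U (S ×ˢ T)) (kernelInt W (S ×ˢ T)) ≤ cutDist dm U W := by
  refine le_ciSup (f := fun ST : {p : Set unitInterval × Set unitInterval //
    MeasurableSet p.1 ∧ MeasurableSet p.2} =>
      dm (kernelInt U (ST.val.1 ×ˢ ST.val.2)) (kernelInt W (ST.val.1 ×ˢ ST.val.2)))
    ?_ ⟨(S, T), hS, hT⟩
  refine (bddAbove_range_dm hdm hweak hU hW).mono ?_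
  rintro _ ⟨ST, rfl⟩
  exact ⟨_, rfl⟩

theorem IsMP.prodMap {φ : unitInterval → unitInterval} (hφ : IsMP φ) :
    MeasurePreserving (fun p : Sq => (φ p.1, φ p.2)) volume volume :=
  MeasurePreserving.prod hφ hφ

theorem IsSubKernel.relabel {Z : Type*} [MeasurableSpace Z] {W : Sq → Measure Z}
    (hW : IsSubKernel W) {φ : unitInterval → unitInterval} (hφ : IsMP φ) :
    IsSubKernel (relabel W φ) :=
  ⟨hW.meas.comp hφ.prodMap.measurable, fun _ => hW.mass _⟩

theorem kernelInt_relabel {Z : Type*} [MeasurableSpace Z] {W : Sq → Measure Z}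
    (hW : Measurable W) {φ : unitInterval → unitInterval} (hφ : IsMP φ) {A : Set Sq}
    (hA : MeasurableSet A) :
    kernelInt (relabel W φ) ((fun p : Sq => (φ p.1, φ p.2)) ⁻¹' A) = kernelInt W A := by
  ext B hB
  rw [kernelInt_apply hW _ hB, kernelInt_apply (W := relabel W φ) (hW.comp hφ.prodMap.measurable) _ hB]
  exact hφ.prodMap.setLIntegral_comp_preimage hA (Measure.measurable_coe hB |>.comp hW)

theorem IsProbGraphon.relabel {Z : Type*} [MeasurableSpace Z] {W : Sq → Measure Z}
    (hW : IsProbGraphon W) {φ : unitInterval → unitInterval} (hφ : IsMP φ) :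
    IsProbGraphon (relabel W φ) :=
  ⟨fun A hA => (hW.1 A hA).comp hφ.prodMap.measurable, fun _ => hW.2 _⟩

theorem MW_relabel {Z : Type*} [MeasurableSpace Z] {W : Sq → Measure Z}
    (hW : Measurable W) {φ : unitInterval → unitInterval} (hφ : IsMP φ) :
    MW (relabel W φ) = MW W := by
  rw [MW_eq_kernelInt, MW_eq_kernelInt, ← kernelInt_relabel hW hφ MeasurableSet.univ,
    Set.preimage_univ]

theorem IsMP.exists_inverse {φ : unitInterval → unitInterval} (hφ : IsMP φ)
    (hbij : Function.Bijective φ) :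
    ∃ ψ : unitInterval → unitInterval, IsMP ψ ∧ Function.Bijective ψ ∧
      (∀ x, ψ (φ x) = x) ∧ ∀ x, φ (ψ x) = x := by
  have he : MeasurableEmbedding φ := hφ.measurable.measurableEmbedding hbij.1
  let e : unitInterval ≃ unitInterval := Equiv.ofBijective φ hbij
  have hmeas : Measurable e.symm := by
    intro s hs
    rw [← Equiv.image_eq_preimage_symm]
    exact he.measurableSet_image' hs
  let e' : unitInterval ≃ᵐ unitInterval := ⟨e, hφ.measurable, hmeas⟩
  have h : MeasurePreserving e' volume volume := hφ
  exact ⟨e'.symm, h.symm e', e'.symm.bijective, e.symm_apply_apply, e.apply_symm_apply⟩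

theorem deltaCut_nonneg {Z : Type*} [MeasurableSpace Z] {dm : Measure Z → Measure Z → ℝ}
    (hdm : IsDistOnSubProb dm) {U W : Sq → Measure Z} (hU : IsSubKernel U) (hW : IsSubKernel W) :
    0 ≤ deltaCut (cutDist dm) U W :=
  Real.iInf_nonneg fun φ => cutDist_nonneg hdm hU (hW.relabel φ.2.1)

theorem deltaCut_le {Z : Type*} [MeasurableSpace Z] {dm : Measure Z → Measure Z → ℝ}
    (hdm : IsDistOnSubProb dm) {U W : Sq → Measure Z} (hU : IsSubKernel U) (hW : IsSubKernel W)
    {φ : unitInterval → unitInterval} (hφ : IsMP φ) (hbij : Function.Bijective φ) :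
    deltaCut (cutDist dm) U W ≤ cutDist dm U (relabel W φ) :=
  ciInf_le (f := fun φ : {φ : unitInterval → unitInterval // IsMP φ ∧ Function.Bijective φ} =>
      cutDist dm U (relabel W φ.val))
    ⟨0, by rintro _ ⟨φ, rfl⟩; exact cutDist_nonneg hdm hU (hW.relabel φ.2.1)⟩ ⟨φ, hφ, hbij⟩

theorem dm_MW_le_deltaCut {Z : Type*} [MeasurableSpace Z] [TopologicalSpace Z]
    [PolishSpace Z] [BorelSpace Z] {dm : Measure Z → Measure Z → ℝ}
    (hdm : IsDistOnSubProb dm) (hweak : InducesWeakTopologySub dm)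
    {U W : Sq → Measure Z} (hU : IsSubKernel U) (hW : IsSubKernel W) :
    dm (MW U) (MW W) ≤ deltaCut (cutDist dm) U W := by
  have : Nonempty {φ : unitInterval → unitInterval // IsMP φ ∧ Function.Bijective φ} :=
    ⟨⟨id, MeasurePreserving.id _, Function.bijective_id⟩⟩
  refine le_ciInf fun φ => ?_
  have h := dm_le_cutDist hdm hweak hU (hW.relabel φ.2.1) MeasurableSet.univ MeasurableSet.univ
  rwa [Set.univ_prod_univ, ← MW_eq_kernelInt, ← MW_eq_kernelInt, MW_relabel hW.meas φ.2.1] at h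

theorem weakTendsto_MW {Z : Type*} [MeasurableSpace Z] [TopologicalSpace Z]
    [PolishSpace Z] [BorelSpace Z] {dm : Measure Z → Measure Z → ℝ}
    (hdm : IsDistOnSubProb dm) (hweak : InducesWeakTopologySub dm)
    {Wn : ℕ → Sq → Measure Z} {W : Sq → Measure Z} (hWn : ∀ n, IsSubKernel (Wn n))
    (hW : IsSubKernel W)
    (h : Tendsto (fun n => deltaCut (cutDist dm) (Wn n) W) atTop (𝓝 0)) :
    WeakTendsto (fun n => MW (Wn n)) (MW W) := by
  have hmem : ∀ V : Sq → Measure Z, IsSubKernel V → MW V ∈ SubProb Z := fun V hV => by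
    rw [MW_eq_kernelInt]; exact hV.kernelInt_mem _
  refine (hweak _ _ (fun n => hmem _ (hWn n)) (hmem _ hW)).1 ?_
  exact squeeze_zero (fun n => hdm.2.1 _ (hmem _ (hWn n)) _ (hmem _ hW))
    (fun n => dm_MW_le_deltaCut hdm hweak (hWn n) hW) h

/-- A family of probability-graphons is tight as soon as every sequence in it has a
subsequence along which the measures `M_W` converge weakly to a probability measure. -/
theorem tightFamily_of_subseq {Z : Type*} [MeasurableSpace Z] [TopologicalSpace Z]
    [PolishSpace Z] [BorelSpace Z] {K : Set (Sq → Measure Z)} (hK : ∀ W ∈ K, IsProbGraphon W)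
    (h : ∀ Wn : ℕ → Sq → Measure Z, (∀ n, Wn n ∈ K) → ∃ (g : ℕ → ℕ) (W : Sq → Measure Z),
      StrictMono g ∧ IsProbGraphon W ∧ WeakTendsto (fun n => MW (Wn (g n))) (MW W)) :
    TightFamily K := by
  let := TopologicalSpace.upgradeIsCompletelyMetrizable Z
  let S : Set (ProbabilityMeasure Z) := {μ | ∃ W ∈ K, (μ : Measure Z) = MW W}
  let : PseudoMetricSpace (ProbabilityMeasure Z) :=
    TopologicalSpace.pseudoMetrizableSpacePseudoMetric _
  have hcomp : IsCompact (closure S) := by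
    refine IsSeqCompact.isCompact fun x hx => ?_
    have hy : ∀ n : ℕ, ∃ y ∈ S, dist (x n) y < 1 / ((n : ℝ) + 1) := fun n =>
      Metric.mem_closure_iff.1 (hx n) _ Nat.one_div_pos_of_nat
    choose y hyS hyd using hy
    choose V hVK hV using hyS
    obtain ⟨g, W, hg, hW, hlim⟩ := h V hVK
    let Q : ProbabilityMeasure Z := ⟨MW W, hW.isProbabilityMeasure_MW⟩
    have h1 : Tendsto (fun n => y (g n)) atTop (𝓝 Q) := by
      rw [ProbabilityMeasure.tendsto_iff_forall_integral_tendsto]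
      intro f
      simp only [hV]
      exact hlim f
    have h2 : Tendsto (fun n => x (g n)) atTop (𝓝 Q) := by
      rw [tendsto_iff_dist_tendsto_zero] at h1 ⊢
      have h3 := (tendsto_one_div_add_atTop_nhds_zero_nat (𝕜 := ℝ)).comp hg.tendsto_atTop
      have h4 := h3.add h1
      rw [zero_add] at h4
      refine squeeze_zero (fun _ => dist_nonneg) (fun n => ?_) h4
      exact (dist_triangle _ (y (g n)) _).trans (add_le_add_left (hyd (g n)).le _)
    exact ⟨Q, isClosed_closure.mem_of_tendsto h2 (Eventually.of_forall fun n => hx _), g, hg, h2⟩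
  have ht := isTightMeasureSet_of_isCompact_closure hcomp
  rw [isTightMeasureSet_iff_exists_isCompact_measure_compl_le] at ht
  intro ε hε
  obtain ⟨K₀, hK₀, hle⟩ := ht ε hε
  refine ⟨K₀, hK₀, fun W hW => ?_⟩
  have := (hK W hW).isProbabilityMeasure_MW
  exact hle _ ⟨⟨MW W, this⟩, ⟨W, hW, rfl⟩, rfl⟩

theorem tightFamily_range_of_tendsto {Z : Type*} [MeasurableSpace Z] [TopologicalSpace Z]
    [PolishSpace Z] [BorelSpace Z] {Wn : ℕ → Sq → Measure Z} {W : Sq → Measure Z}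
    (hWn : ∀ n, IsProbGraphon (Wn n)) (hW : IsProbGraphon W)
    (h : WeakTendsto (fun n => MW (Wn n)) (MW W)) : TightFamily (Set.range Wn) := by
  let P : ℕ → ProbabilityMeasure Z := fun n => ⟨MW (Wn n), (hWn n).isProbabilityMeasure_MW⟩
  let Q : ProbabilityMeasure Z := ⟨MW W, hW.isProbabilityMeasure_MW⟩
  let := TopologicalSpace.upgradeIsCompletelyMetrizable Z
  have h1 : Tendsto P atTop (𝓝 Q) := by
    rw [ProbabilityMeasure.tendsto_iff_forall_integral_tendsto]
    exact h
  have hcomp : IsCompact (closure (Set.range P)) :=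
    h1.isCompact_insert_range.closure_of_subset (Set.subset_insert _ _)
  have ht := isTightMeasureSet_of_isCompact_closure hcomp
  rw [isTightMeasureSet_iff_exists_isCompact_measure_compl_le] at ht
  intro ε hε
  obtain ⟨K₀, hK₀, hle⟩ := ht ε hε
  refine ⟨K₀, hK₀, ?_⟩
  rintro _ ⟨n, rfl⟩
  exact hle _ ⟨P n, ⟨n, rfl⟩, rfl⟩

/-- The map of `[0,1]` that permutes the intervals `[i/N, (i+1)/N)` according to `τ`. -/
def intervalPerm (N : ℕ) (τ : Equiv.Perm ℕ) (x : unitInterval) : unitInterval :=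
  Set.projIcc (0 : ℝ) 1 zero_le_one
    ((x : ℝ) + ((τ ⌊(N : ℝ) * x⌋₊ : ℝ) - ⌊(N : ℝ) * x⌋₊) / N)

theorem coe_intervalPerm {N : ℕ} (hN : 0 < N) {τ : Equiv.Perm ℕ} (hτ : ∀ i, i < N → τ i < N)
    (hτ' : ∀ i, N ≤ i → τ i = i) (x : unitInterval) :
    (intervalPerm N τ x : ℝ) = (x : ℝ) + ((τ ⌊(N : ℝ) * x⌋₊ : ℝ) - ⌊(N : ℝ) * x⌋₊) / N := by
  have hN' : (0 : ℝ) < N := by exact_mod_cast hN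
  have hx0 : (0 : ℝ) ≤ N * x := mul_nonneg hN'.le x.2.1
  rw [intervalPerm, Set.projIcc_of_mem]
  set i := ⌊(N : ℝ) * x⌋₊ with hi
  have h1 : (i : ℝ) ≤ N * x := Nat.floor_le hx0
  have h2 : (N : ℝ) * x < i + 1 := Nat.lt_floor_add_one _
  have key : (x : ℝ) + ((τ i : ℝ) - i) / N = (N * x - i + τ i) / N := by
    field_simp; ring
  rw [key]
  refine ⟨div_nonneg (by have : (0 : ℝ) ≤ τ i := by positivity
                         linarith) hN'.le, ?_⟩
  rw [div_le_one hN']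
  rcases lt_or_ge i N with h | h
  · have h3 : (τ i : ℝ) + 1 ≤ N := by exact_mod_cast hτ i h
    linarith
  · rw [hτ' i h]
    have := mul_le_mul_of_nonneg_left x.2.2 hN'.le
    linarith

theorem floor_intervalPerm {N : ℕ} (hN : 0 < N) {τ : Equiv.Perm ℕ} (hτ : ∀ i, i < N → τ i < N)
    (hτ' : ∀ i, N ≤ i → τ i = i) (x : unitInterval) :
    ⌊(N : ℝ) * intervalPerm N τ x⌋₊ = τ ⌊(N : ℝ) * x⌋₊ := by
  have hN' : (0 : ℝ) < N := by exact_mod_cast hN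
  have hx0 : (0 : ℝ) ≤ N * x := mul_nonneg hN'.le x.2.1
  rw [coe_intervalPerm hN hτ hτ']
  set i := ⌊(N : ℝ) * x⌋₊ with hi
  have h1 : (i : ℝ) ≤ N * x := Nat.floor_le hx0
  have h2 : (N : ℝ) * x < i + 1 := Nat.lt_floor_add_one _
  have key : (N : ℝ) * ((x : ℝ) + ((τ i : ℝ) - i) / N) = N * x - i + τ i := by
    field_simp; ring
  rw [key, Nat.floor_eq_iff (by have : (0 : ℝ) ≤ τ i := by positivity
                                linarith)]
  constructor <;> linarith

theorem intervalPerm_symm {N : ℕ} (hN : 0 < N) {τ : Equiv.Perm ℕ} (hτ : ∀ i, i < N → τ i < N)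
    (hτ' : ∀ i, N ≤ i → τ i = i) (hs : ∀ i, i < N → τ.symm i < N)
    (hs' : ∀ i, N ≤ i → τ.symm i = i) (x : unitInterval) :
    intervalPerm N τ.symm (intervalPerm N τ x) = x := by
  apply Subtype.ext
  rw [coe_intervalPerm hN hs hs', floor_intervalPerm hN hτ hτ', coe_intervalPerm hN hτ hτ',
    Equiv.symm_apply_apply]
  ring

theorem measurable_intervalPerm (N : ℕ) (τ : Equiv.Perm ℕ) : Measurable (intervalPerm N τ) := by
  refine continuous_projIcc.measurable.comp ?_
  have h1 : Measurable fun x : unitInterval => ⌊(N : ℝ) * x⌋₊ :=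
    Nat.measurable_floor.comp (measurable_subtype_coe.const_mul _)
  have h2 : Measurable fun n : ℕ => ((τ n : ℝ) - n) / N := measurable_of_countable _
  exact measurable_subtype_coe.add (h2.comp h1)

theorem isMP_intervalPerm {N : ℕ} (hN : 0 < N) {τ : Equiv.Perm ℕ} (hτ : ∀ i, i < N → τ i < N)
    (hτ' : ∀ i, N ≤ i → τ i = i) : IsMP (intervalPerm N τ) := by
  have hN' : (0 : ℝ) < N := by exact_mod_cast hN
  have hm := measurable_intervalPerm N τ
  refine ⟨hm, ?_⟩
  have hfl : Measurable fun x : unitInterval => ⌊(N : ℝ) * x⌋₊ :=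
    Nat.measurable_floor.comp (measurable_subtype_coe.const_mul _)
  have hcell : ∀ i, MeasurableSet {x : unitInterval | ⌊(N : ℝ) * x⌋₊ = i} := fun i =>
    hfl (measurableSet_singleton i)
  have hsum : ∀ A : Set unitInterval, MeasurableSet A →
      volume A = ∑' i, volume ({x : unitInterval | ⌊(N : ℝ) * x⌋₊ = i} ∩ A) := by
    intro A hA
    rw [← measure_iUnion]
    · congr 1; ext x; simp
    · intro i j hij
      refine Set.disjoint_left.2 fun x hx hx' => hij ?_
      exact hx.1.symm.trans hx'.1
    · exact fun i => (hcell i).inter hA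
  ext A hA
  rw [Measure.map_apply hm hA, hsum _ (hm hA), hsum _ hA]
  symm
  rw [← Equiv.tsum_eq τ]
  congr 1; ext i
  rw [unitInterval.volume_apply, unitInterval.volume_apply,
    ← measure_preimage_add_right volume (((τ i : ℝ) - i) / N)]
  congr 1
  ext y
  simp only [Set.mem_image, Set.mem_inter_iff, Set.mem_preimage, Set.mem_ofPred_eq]
  rw [iff_comm]
  constructor
  · rintro ⟨x, ⟨hx, hxA⟩, rfl⟩
    refine ⟨intervalPerm N τ x, ⟨?_, hxA⟩, ?_⟩
    · rw [floor_intervalPerm hN hτ hτ', hx]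
    · rw [coe_intervalPerm hN hτ hτ', hx]
  · rintro ⟨z, ⟨hz, hzA⟩, hzy⟩
    have hs : ∀ i, i < N → τ.symm i < N := fun i hi => by
      by_contra h
      have := hτ' _ (not_lt.1 h)
      rw [Equiv.apply_symm_apply] at this
      omega
    have hs' : ∀ i, N ≤ i → τ.symm i = i := fun i hi => by
      rw [Equiv.symm_apply_eq, hτ' i hi]
    have h1 : intervalPerm N τ (intervalPerm N τ.symm z) = z := by
      have := intervalPerm_symm (τ := τ.symm) hN hs hs' hτ hτ' z
      rwa [Equiv.symm_symm] at this
    refine ⟨intervalPerm N τ.symm z, ⟨?_, ?_⟩, ?_⟩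
    · rw [floor_intervalPerm hN hs hs', hz, Equiv.symm_apply_apply]
    · rw [h1]; exact hzA
    · rw [coe_intervalPerm hN hs hs', hz, Equiv.symm_apply_apply, hzy]
      ring

theorem bijective_intervalPerm {N : ℕ} (hN : 0 < N) {τ : Equiv.Perm ℕ}
    (hτ : ∀ i, i < N → τ i < N) (hτ' : ∀ i, N ≤ i → τ i = i) :
    Function.Bijective (intervalPerm N τ) := by
  have hs : ∀ i, i < N → τ.symm i < N := fun i hi => by
    by_contra h
    have := hτ' _ (not_lt.1 h)
    rw [Equiv.apply_symm_apply] at this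
    omega
  have hs' : ∀ i, N ≤ i → τ.symm i = i := fun i hi => by
    rw [Equiv.symm_apply_eq, hτ' i hi]
  refine Function.bijective_iff_has_inverse.2 ⟨intervalPerm N τ.symm,
    intervalPerm_symm hN hτ hτ' hs hs', ?_⟩
  have := intervalPerm_symm (τ := τ.symm) hN hs hs' hτ hτ'
  rwa [Equiv.symm_symm] at this

/-- A bounded integer-valued function on `[0,1]` becomes monotone, up to a set of small
measure, after composition with a suitable measure-preserving bijection. -/
theorem exists_isMP_monotone {J : unitInterval → ℕ} (hJ : Measurable J) {B : ℕ}
    (hB : ∀ x, J x ≤ B) {ε : ℝ≥0∞} (hε : 0 < ε) :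
    ∃ (φ : unitInterval → unitInterval) (J' : unitInterval → ℕ), IsMP φ ∧
      Function.Bijective φ ∧ Monotone J' ∧ volume {x | J (φ x) ≠ J' x} < ε := by
  obtain ⟨δ, hδ0, hδε⟩ := exists_between hε
  have hJm : Measurable fun x => (J x : ℝ) := measurable_from_nat.comp hJ
  have hLp : MemLp (fun x => (J x : ℝ)) 1 (volume : Measure unitInterval) :=
    MemLp.of_bound hJm.aestronglyMeasurable B (Eventually.of_forall fun x => by
      simpa using hB x)
  have h4 : ENNReal.ofReal (1 / 4) ≠ 0 := by simp
  obtain ⟨f, hf, -⟩ := hLp.exists_boundedContinuous_eLpNorm_sub_le ENNReal.one_ne_top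
    (ε := ENNReal.ofReal (1 / 4) * δ) (mul_ne_zero h4 hδ0.ne')
  have hbad : volume {x | ENNReal.ofReal (1 / 4) ≤ ‖(J x : ℝ) - f x‖ₑ} ≤ δ := by
    have h1 := mul_meas_ge_le_lintegral₀ (μ := (volume : Measure unitInterval))
      (f := fun x => ‖(J x : ℝ) - f x‖ₑ)
      ((hJm.sub f.continuous.measurable).enorm).aemeasurable (ENNReal.ofReal (1 / 4))
    rw [eLpNorm_one_eq_lintegral_enorm] at hf
    have h2 := h1.trans hf
    exact (ENNReal.mul_le_mul_iff_right h4 ENNReal.ofReal_ne_top).1 h2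
  have hu : UniformContinuous f := CompactSpace.uniformContinuous_of_continuous f.continuous
  obtain ⟨r, hr0, hr⟩ := Metric.uniformContinuous_iff.1 hu (1 / 4) (by norm_num)
  obtain ⟨M, hM⟩ := exists_nat_one_div_lt hr0
  set N := M + 1 with hNdef
  have hN : 0 < N := Nat.succ_pos _
  have hN' : (0 : ℝ) < N := by exact_mod_cast hN
  let a : Fin N → ℕ := fun i => (round (f (Set.projIcc (0 : ℝ) 1 zero_le_one ((i : ℝ) / N)))).toNat
  let τ : Equiv.Perm ℕ := (Tuple.sort a).extendDomain Fin.equivSubtype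
  have hτ1 : ∀ i (h : i < N), τ i = Tuple.sort a ⟨i, h⟩ := fun i h => by
    have := Equiv.Perm.extendDomain_apply_subtype (Tuple.sort a) (Fin.equivSubtype (n := N)) h
    exact this
  have hτ : ∀ i, i < N → τ i < N := fun i h => by
    rw [hτ1 i h]; exact Fin.is_lt _
  have hτ' : ∀ i, N ≤ i → τ i = i := fun i h =>
    Equiv.Perm.extendDomain_apply_not_subtype _ _ (not_lt.2 h)
  let b : ℕ → ℕ := fun i => a (Tuple.sort a ⟨min i M, by omega⟩)
  have hb : Monotone b := fun i j hij =>
    Tuple.monotone_sort a (Fin.mk_le_mk.2 (min_le_min_right M hij))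
  refine ⟨intervalPerm N τ, fun x => b ⌊(N : ℝ) * x⌋₊, isMP_intervalPerm hN hτ hτ',
    bijective_intervalPerm hN hτ hτ', fun x y hxy => hb (Nat.floor_mono
      (mul_le_mul_of_nonneg_left hxy hN'.le)), ?_⟩
  have hφ := isMP_intervalPerm hN hτ hτ'
  have hsub : {x | J (intervalPerm N τ x) ≠ b ⌊(N : ℝ) * x⌋₊} ⊆
      intervalPerm N τ ⁻¹' {x | ENNReal.ofReal (1 / 4) ≤ ‖(J x : ℝ) - f x‖ₑ} ∪ {1} := by
    intro x hx
    by_contra hcon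
    simp only [Set.mem_union, Set.mem_preimage, Set.mem_ofPred_eq, Set.mem_singleton_iff,
      not_or, not_le] at hcon
    obtain ⟨h1, h2⟩ := hcon
    apply hx
    have hx1 : (x : ℝ) < 1 := lt_of_le_of_ne x.2.2 fun h => h2 (Subtype.ext h)
    have hi : ⌊(N : ℝ) * x⌋₊ < N := by
      rw [Nat.floor_lt (mul_nonneg hN'.le x.2.1)]
      nlinarith
    have hfl := floor_intervalPerm hN hτ hτ' x
    set y := intervalPerm N τ x
    set i := ⌊(N : ℝ) * x⌋₊
    have hbi : b i = a ⟨τ i, hτ i hi⟩ := by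
      have : (⟨min i M, by omega⟩ : Fin N) = ⟨i, hi⟩ := by
        apply Fin.ext; simp; omega
      simp only [b, this]
      congr 1
      apply Fin.ext
      exact (hτ1 i hi).symm
    rw [hbi]
    have hy0 : (0 : ℝ) ≤ N * y := mul_nonneg hN'.le y.2.1
    have hy1 : ((τ i : ℕ) : ℝ) ≤ N * y := by rw [← hfl]; exact Nat.floor_le hy0
    have hy2 : (N : ℝ) * y < (τ i : ℕ) + 1 := by rw [← hfl]; exact Nat.lt_floor_add_one _
    have hmem : ((τ i : ℕ) : ℝ) / N ∈ Set.Icc (0 : ℝ) 1 :=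
      ⟨by positivity, by rw [div_le_one hN']; exact_mod_cast (hτ i hi).le⟩
    have hd : dist y (Set.projIcc (0 : ℝ) 1 zero_le_one (((τ i : ℕ) : ℝ) / N)) < r := by
      rw [Set.projIcc_of_mem _ hmem, Subtype.dist_eq, Real.dist_eq]
      refine lt_of_le_of_lt ?_ hM
      have h3 : (y : ℝ) - ((τ i : ℕ) : ℝ) / N = (N * y - (τ i : ℕ)) / N := by field_simp
      have h4 : ((M : ℝ) + 1) = N := by simp [hNdef]
      rw [h3, h4, abs_div, abs_of_pos hN', div_le_div_iff_of_pos_right hN', abs_le]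
      constructor <;> linarith
    have h3 := hr hd
    rw [Real.dist_eq] at h3
    have h5 : |(J y : ℝ) - f y| < 1 / 4 := by
      rw [Real.enorm_eq_ofReal_abs] at h1
      exact (ENNReal.ofReal_lt_ofReal_iff (by norm_num)).1 h1
    have h6 : round (f (Set.projIcc (0 : ℝ) 1 zero_le_one (((τ i : ℕ) : ℝ) / N))) = (J y : ℤ) := by
      rw [round_eq, Int.floor_eq_iff]
      rw [abs_lt] at h3 h5
      push_cast
      constructor <;> linarith [h3.1, h3.2, h5.1, h5.2]
    simp only [a]
    rw [h6, Int.toNat_natCast]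
  have hz : volume ({1} : Set unitInterval) = 0 := measure_singleton _
  calc volume {x | J (intervalPerm N τ x) ≠ b ⌊(N : ℝ) * x⌋₊}
      ≤ _ := measure_mono hsub
    _ ≤ volume (intervalPerm N τ ⁻¹' {x | ENNReal.ofReal (1 / 4) ≤ ‖(J x : ℝ) - f x‖ₑ})
          + volume ({1} : Set unitInterval) := measure_union_le _ _
    _ = volume {x | ENNReal.ofReal (1 / 4) ≤ ‖(J x : ℝ) - f x‖ₑ} := by
        rw [hz, add_zero]
        refine hφ.measure_preimage (MeasurableSet.nullMeasurableSet ?_)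
        exact measurableSet_le measurable_const (hJm.sub f.continuous.measurable).enorm
    _ ≤ δ := hbad
    _ < ε := hδε

/-- A Helly selection theorem for monotone integer-valued functions on `[0,1]`. -/
theorem exists_subseq_ae_eventually_const {u : ℕ → ℕ → unitInterval → ℕ} {N : ℕ → ℕ}
    (hu : ∀ k n, Monotone (u k n)) (hN : ∀ k n x, u k n x ≤ N k) :
    ∃ g : ℕ → ℕ, StrictMono g ∧ ∀ k, ∀ᵐ x : unitInterval, ∃ l,
      ∀ᶠ n in atTop, u k (g n) x = l := by
  let D := TopologicalSpace.denseSeq unitInterval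
  let X : ℕ → ((p : ℕ × ℕ) → Fin (N p.1 + 1)) := fun n p =>
    ⟨u p.1 n (D p.2), Nat.lt_succ_of_le (hN _ _ _)⟩
  obtain ⟨v, g, hg, hlim⟩ := CompactSpace.tendsto_subseq X
  have hv : ∀ k i, ∀ᶠ n in atTop, u k (g n) (D i) = v (k, i) := by
    intro k i
    have h1 := (tendsto_pi_nhds.1 hlim) (k, i)
    rw [nhds_discrete, tendsto_pure] at h1
    filter_upwards [h1] with n hn
    rw [← hn]
    rfl
  have hvm : ∀ k i j, D i ≤ D j → (v (k, i) : ℕ) ≤ v (k, j) := by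
    intro k i j hij
    obtain ⟨n, h1, h2⟩ := ((hv k i).and (hv k j)).exists
    rw [← h1, ← h2]
    exact hu _ _ hij
  refine ⟨g, hg, fun k => ?_⟩
  let bad : Set unitInterval := {x | ¬∃ l, ∀ᶠ n in atTop, u k (g n) x = l}
  have hbad : ∀ x ∈ bad, ∀ i j, D i ≤ x → x ≤ D j → (v (k, i) : ℕ) ≠ v (k, j) := by
    intro x hx i j hi hj heq
    refine hx ⟨v (k, i), ?_⟩
    filter_upwards [hv k i, hv k j] with n h1 h2
    refine le_antisymm ?_ ?_
    · rw [heq, ← h2]; exact hu _ _ hj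
    · rw [← h1]; exact hu _ _ hi
  let c : unitInterval → ℕ := fun x => sInf {a | ∃ i, x ≤ D i ∧ a = v (k, i)}
  have hdense := TopologicalSpace.denseRange_denseSeq unitInterval
  have hbetween : ∀ x y : unitInterval, x < y → ∃ i, x < D i ∧ D i < y := by
    intro x y hxy
    obtain ⟨_, ⟨i, rfl⟩, hz⟩ := hdense.exists_between hxy
    exact ⟨i, hz⟩
  have hlt : ∀ x ∈ bad ∩ Set.Iio 1, ∀ y ∈ bad ∩ Set.Iio 1, x < y → c x ≠ c y := by
    rintro x ⟨hx, hx1⟩ y ⟨hy, hy1⟩ hxy heq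
    obtain ⟨i, hi1, hi2⟩ := hbetween x y hxy
    have hne : {a | ∃ i, y ≤ D i ∧ a = (v (k, i) : ℕ)}.Nonempty := by
      obtain ⟨j, hj, -⟩ := hbetween y 1 hy1
      exact ⟨_, j, hj.le, rfl⟩
    obtain ⟨j, hj1, hj2⟩ := Nat.sInf_mem hne
    have h1 : c x ≤ v (k, i) := Nat.sInf_le ⟨i, hi1.le, rfl⟩
    have h2 : c y = v (k, j) := hj2
    exact hbad y hy i j hi2.le hj1 (le_antisymm (hvm k i j (hi2.le.trans hj1)) (by omega))
  have hinj : Set.InjOn c (bad ∩ Set.Iio 1) := by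
    intro x hx y hy hxy
    by_contra hne
    rcases lt_or_gt_of_ne hne with h | h
    · exact hlt x hx y hy h hxy
    · exact hlt y hy x hx h hxy.symm
  have hcount : (bad ∩ Set.Iio 1).Countable :=
    Set.countable_of_injective_of_countable_image hinj (Set.to_countable _)
  have hall : bad ⊆ (bad ∩ Set.Iio 1) ∪ {1} := by
    intro x hx
    rcases eq_or_lt_of_le (unitInterval.le_one' (t := x)) with h | h
    · exact Or.inr h
    · exact Or.inl ⟨hx, h⟩
  rw [ae_iff]
  exact ((hcount.union (Set.countable_singleton _)).mono hall).measure_zero _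

/-- The value of the first `k` digits `d 0, …, d (k - 1)` in mixed radix `m`. -/
def mixedRadix (m d : ℕ → ℕ) : ℕ → ℕ
  | 0 => 0
  | k + 1 => mixedRadix m d k * m k + d k

theorem mixedRadix_succ_div {m d : ℕ → ℕ} (h : ∀ k, d k < m k) (k : ℕ) :
    mixedRadix m d (k + 1) / m k = mixedRadix m d k := by
  have := h k
  rw [mixedRadix, mul_comm, Nat.mul_add_div (by omega), Nat.div_eq_of_lt this, add_zero]

theorem mixedRadix_succ_mod {m d : ℕ → ℕ} (h : ∀ k, d k < m k) (k : ℕ) :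
    mixedRadix m d (k + 1) % m k = d k := by
  rw [mixedRadix, mul_comm, Nat.mul_add_mod, Nat.mod_eq_of_lt (h k)]

theorem mixedRadix_le (m : ℕ → ℕ) (k : ℕ) :
    ∃ N, ∀ d : ℕ → ℕ, (∀ k, d k < m k) → mixedRadix m d k ≤ N := by
  induction k with
  | zero => exact ⟨0, fun _ _ => le_rfl⟩
  | succ k ih =>
    obtain ⟨N, hN⟩ := ih
    refine ⟨N * m k + m k, fun d hd => ?_⟩
    rw [mixedRadix]
    exact Nat.add_le_add (Nat.mul_le_mul_right _ (hN d hd)) (hd k).le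

theorem exists_monotone_mixedRadix (m : ℕ → ℕ) (k j : ℕ) :
    ∃ r : ℕ → ℕ, Monotone r ∧
      ∀ d : ℕ → ℕ, (∀ k, d k < m k) → r (mixedRadix m d (k + j)) = mixedRadix m d k := by
  induction j with
  | zero => exact ⟨id, monotone_id, fun _ _ => rfl⟩
  | succ j ih =>
    obtain ⟨r, hr, h⟩ := ih
    refine ⟨fun a => r (a / m (k + j)), fun a b hab => hr (Nat.div_le_div_right hab),
      fun d hd => ?_⟩
    rw [← h d hd, ← mixedRadix_succ_div hd (k + j)]
    rfl

/-- Countably many sequences of bounded integer-valued functions can be made to converge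
almost everywhere, along a subsequence, by relabeling each term with one
measure-preserving bijection. -/
theorem exists_isMP_ae_eventually_const {idx : ℕ → ℕ → unitInterval → ℕ} {m : ℕ → ℕ}
    (hidx : ∀ k n, Measurable (idx k n)) (hlt : ∀ k n x, idx k n x < m k) :
    ∃ (φ : ℕ → unitInterval → unitInterval) (g : ℕ → ℕ), (∀ n, IsMP (φ n)) ∧
      (∀ n, Function.Bijective (φ n)) ∧ StrictMono g ∧
      ∀ k, ∀ᵐ x : unitInterval, ∃ l, ∀ᶠ n in atTop, idx k (g n) (φ (g n) x) = l := by
  choose N hN using mixedRadix_le m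
  choose r hr hrd using exists_monotone_mixedRadix m
  have hmeas : ∀ n k, Measurable fun x => mixedRadix m (fun i => idx i n x) k := by
    intro n k
    induction k with
    | zero => exact measurable_const
    | succ k ih => exact (ih.mul_const _).add (hidx k n)
  obtain ⟨ε, hε0, hε⟩ := ENNReal.exists_pos_sum_of_countable' (one_ne_zero (α := ℝ≥0∞)) ℕ
  choose φ J' hφ hbij hJ' hbad using fun n =>
    exists_isMP_monotone (hmeas n n) (fun x => hN n _ fun k => hlt k n x) (hε0 n)
  have hBC : ∀ᵐ x : unitInterval, ∀ᶠ n in atTop,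
      mixedRadix m (fun i => idx i n (φ n x)) n = J' n x := by
    have h1 := measure_setOfPred_frequently_eq_zero (μ := (volume : Measure unitInterval))
      (p := fun n x => mixedRadix m (fun i => idx i n (φ n x)) n ≠ J' n x)
      (ne_top_of_le_ne_top (hε.trans (by simp)).ne (ENNReal.tsum_le_tsum fun n => (hbad n).le))
    filter_upwards [measure_eq_zero_iff_ae_notMem.1 h1] with x hx
    simpa [Filter.Frequently] using hx
  let u : ℕ → ℕ → unitInterval → ℕ := fun k n x => min (r k (n - k) (J' n x)) (N k)
  obtain ⟨g, hg, hconst⟩ := exists_subseq_ae_eventually_const (u := u) (N := N)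
    (fun k n x y hxy => min_le_min_right _ (hr _ _ (hJ' n hxy))) fun k n x => min_le_right _ _
  have hu : ∀ᵐ x : unitInterval, ∀ k, ∀ᶠ n in atTop,
      u k (g n) x = mixedRadix m (fun i => idx i (g n) (φ (g n) x)) k := by
    filter_upwards [hBC] with x hx k
    filter_upwards [hg.tendsto_atTop.eventually hx,
      hg.tendsto_atTop.eventually (eventually_ge_atTop k)] with n hn hk
    have hd : ∀ i, idx i (g n) (φ (g n) x) < m i := fun i => hlt _ _ _
    have h1 := hrd k (g n - k) _ hd
    rw [Nat.add_sub_cancel' hk, hn] at h1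
    simp only [u, h1]
    exact min_eq_left (hN k _ hd)
  refine ⟨φ, g, hφ, hbij, hg, fun k => ?_⟩
  filter_upwards [hconst (k + 1), hu] with x ⟨l, hl⟩ hx
  refine ⟨l % m k, ?_⟩
  filter_upwards [hl, hx (k + 1)] with n h1 h2
  rw [← h1, h2]
  exact (mixedRadix_succ_mod (fun i => hlt i _ _) k).symm

/-- Convergence of integrals against bounded continuous functions upgrades, for uniformly
bounded sequences of functions, to convergence of integrals on measurable sets. -/
theorem tendsto_setIntegral_of_tendsto_integral_mul {X : Type*} [TopologicalSpace X]
    [NormalSpace X] [MeasurableSpace X] [BorelSpace X] {μ : Measure X} [IsFiniteMeasure μ]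
    [μ.WeaklyRegular] {F : ℕ → X → ℝ} {G : X → ℝ} {C : ℝ} (hF : ∀ n, Measurable (F n))
    (hG : Measurable G) (hFC : ∀ n x, |F n x| ≤ C) (hGC : ∀ x, |G x| ≤ C)
    (h : ∀ k : BoundedContinuousFunction X ℝ,
      Tendsto (fun n => ∫ x, k x * F n x ∂μ) atTop (𝓝 (∫ x, k x * G x ∂μ)))
    {A : Set X} (hA : MeasurableSet A) :
    Tendsto (fun n => ∫ x in A, F n x ∂μ) atTop (𝓝 (∫ x in A, G x ∂μ)) := by
  rcases isEmpty_or_nonempty X with hX | ⟨⟨x₀⟩⟩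
  · simp [Measure.eq_zero_of_isEmpty μ]
  have hC : 0 ≤ C := (abs_nonneg _).trans (hGC x₀)
  have hind : Integrable (A.indicator (1 : X → ℝ)) μ :=
    (integrable_const (1 : ℝ)).indicator hA
  rw [Metric.tendsto_atTop]
  intro ε hε
  obtain ⟨k, hk, hki⟩ := hind.exists_boundedContinuous_integral_sub_le
    (ε := ε / (4 * (C + 1))) (by positivity)
  have key : ∀ H : X → ℝ, Measurable H → (∀ x, |H x| ≤ C) →
      |∫ x in A, H x ∂μ - ∫ x, k x * H x ∂μ| ≤ ε / 4 := by
    intro H hH hHC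
    have h1 : ∫ x in A, H x ∂μ = ∫ x, A.indicator (1 : X → ℝ) x * H x ∂μ := by
      rw [← integral_indicator hA]
      congr 1; ext x
      by_cases hx : x ∈ A <;> simp [hx]
    have hi1 : Integrable (fun x => A.indicator (1 : X → ℝ) x * H x) μ :=
      hind.mul_bdd (c := C) hH.aestronglyMeasurable (Eventually.of_forall hHC)
    have hi2 : Integrable (fun x => k x * H x) μ :=
      hki.mul_bdd (c := C) hH.aestronglyMeasurable (Eventually.of_forall hHC)
    rw [h1, ← integral_sub hi1 hi2]
    calc |∫ x, (A.indicator (1 : X → ℝ) x * H x - k x * H x) ∂μ|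
        ≤ ∫ x, ‖A.indicator (1 : X → ℝ) x * H x - k x * H x‖ ∂μ := by
          rw [← Real.norm_eq_abs]
          exact norm_integral_le_integral_norm _
      _ ≤ ∫ x, ‖A.indicator (1 : X → ℝ) x - k x‖ * C ∂μ := by
          refine integral_mono (hi1.sub hi2).norm ((hind.sub hki).norm.mul_const C) fun x => ?_
          simp only
          rw [← sub_mul, norm_mul]
          exact mul_le_mul_of_nonneg_left (hHC x) (norm_nonneg _)
      _ ≤ ε / (4 * (C + 1)) * C := by
          rw [integral_mul_const]
          exact mul_le_mul_of_nonneg_right hk hC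
      _ ≤ ε / 4 := by
          rw [div_mul_eq_mul_div, div_le_div_iff₀ (by positivity) (by positivity)]
          nlinarith
  obtain ⟨N, hN⟩ := Metric.tendsto_atTop.1 (h k) (ε / 4) (by positivity)
  refine ⟨N, fun n hn => ?_⟩
  have h1 := key (F n) (hF n) (hFC n)
  have h2 := key G hG hGC
  have h3 := hN n hn
  rw [Real.dist_eq] at h3 ⊢
  rw [abs_le] at h1 h2
  rw [abs_lt] at h3 ⊢
  constructor <;> linarith [h1.1, h1.2, h2.1, h2.2, h3.1, h3.2]

theorem IsSubKernel.integral_compProd_mul {Z : Type*} [MeasurableSpace Z] [TopologicalSpace Z]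
    [OpensMeasurableSpace Z] {W : Sq → Measure Z} (hW : IsSubKernel W)
    (h : BoundedContinuousFunction Sq ℝ) (f : BoundedContinuousFunction Z ℝ) :
    ∫ q, h q.1 * f q.2 ∂((volume : Measure Sq).compProd (toKernel W hW.meas))
      = ∫ p, h p * ∫ z, f z ∂(W p) := by
  have := hW.isFiniteKernel
  rw [Measure.integral_compProd]
  · simp only [integral_const_mul]
    rfl
  · refine Integrable.of_bound (C := ‖h‖ * ‖f‖) (Measurable.aestronglyMeasurable ?_)
      (Eventually.of_forall fun q => ?_)
    · exact (h.continuous.measurable.comp measurable_fst).mul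
        (f.continuous.measurable.comp measurable_snd)
    · rw [norm_mul]
      exact mul_le_mul (h.norm_coe_le_norm _) (f.norm_coe_le_norm _) (norm_nonneg _)
        (norm_nonneg _)

/-- A tight sequence of probability-graphons has a subsequence converging to a
probability-graphon, weakly on every measurable subset of the square. -/
theorem exists_subseq_weakTendsto_kernelInt {Z : Type*} [MeasurableSpace Z]
    [TopologicalSpace Z] [PolishSpace Z] [BorelSpace Z] {U : ℕ → Sq → Measure Z}
    (hU : ∀ n, IsProbGraphon (U n)) (ht : TightFamily (Set.range U)) :
    ∃ (g : ℕ → ℕ) (W : Sq → Measure Z), StrictMono g ∧ IsProbGraphon W ∧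
      ∀ A, MeasurableSet A →
        WeakTendsto (fun n => kernelInt (U (g n)) A) (kernelInt W A) := by
  have hk : ∀ n, ProbabilityTheory.IsMarkovKernel (toKernel (U n) (hU n).isSubKernel.meas) :=
    fun n => ⟨fun p => (hU n).2 p⟩
  let M : ℕ → ProbabilityMeasure (Sq × Z) := fun n =>
    ⟨(volume : Measure Sq).compProd (toKernel (U n) (hU n).isSubKernel.meas), inferInstance⟩
  have hfst : ∀ n, (M n : Measure (Sq × Z)).fst = volume := fun n => Measure.fst_compProd _ _
  have hsnd : ∀ n, (M n : Measure (Sq × Z)).snd = MW (U n) := fun n => Measure.snd_compProd _ _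
  have htight : IsTightMeasureSet (Set.range fun n => (M n : Measure (Sq × Z))) := by
    refine IsTightMeasureSet.prodMk IsTightMeasureSet.of_compactSpace ?_
    rw [isTightMeasureSet_iff_exists_isCompact_measure_compl_le]
    intro ε hε
    obtain ⟨K₀, hK₀, hle⟩ := ht ε hε
    refine ⟨K₀, hK₀, ?_⟩
    rintro _ ⟨_, ⟨n, rfl⟩, rfl⟩
    simp only [hsnd]
    exact hle _ ⟨n, rfl⟩
  obtain ⟨g, Q, hg, hlim⟩ := exists_subseq_tendsto_of_isTight M htight
  have hQ : (Q : Measure (Sq × Z)).fst = volume := by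
    have h1 := ProbabilityMeasure.tendsto_map_of_tendsto_of_continuous _ _ hlim
      (continuous_fst (X := Sq) (Y := Z))
    let V : ProbabilityMeasure Sq := ⟨volume, inferInstance⟩
    have h2 : (fun n => (M (g n)).map
        (continuous_fst (X := Sq) (Y := Z)).measurable.aemeasurable) = fun _ => V := by
      ext1 n
      apply Subtype.ext
      exact hfst _
    rw [h2] at h1
    have h3 := tendsto_nhds_unique h1 tendsto_const_nhds
    exact congrArg Subtype.val h3
  have hne : Nonempty Z := by
    have := (hU 0).2 (0, 0)
    exact nonempty_of_isProbabilityMeasure (U 0 (0, 0))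
  let κ := (Q : Measure (Sq × Z)).condKernel
  let W : Sq → Measure Z := κ
  have hW : IsProbGraphon W := by
    refine ⟨fun A hA => ProbabilityTheory.Kernel.measurable_coe κ hA, fun p => ?_⟩
    exact ProbabilityTheory.IsMarkovKernel.isProbabilityMeasure p
  have hdis : (Q : Measure (Sq × Z)) =
      (volume : Measure Sq).compProd (toKernel W hW.isSubKernel.meas) := by
    have h1 := Measure.disintegrate (Q : Measure (Sq × Z)) κ
    rw [hQ] at h1
    exact h1.symm
  refine ⟨g, W, hg, hW, fun A hA f => ?_⟩
  simp only [fun n => (hU n).isSubKernel.integral_kernelInt A f,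
    hW.isSubKernel.integral_kernelInt A f]
  refine tendsto_setIntegral_of_tendsto_integral_mul
    (fun n => (hU _).isSubKernel.measurable_integral f) (hW.isSubKernel.measurable_integral f)
    (fun n p => (hU _).isSubKernel.abs_integral_le f p) (hW.isSubKernel.abs_integral_le f)
    (fun h => ?_) hA
  have h1 := ProbabilityMeasure.tendsto_iff_forall_integral_tendsto.1 hlim
    ((h.compContinuous ⟨Prod.fst, continuous_fst⟩) * (f.compContinuous ⟨Prod.snd, continuous_snd⟩))
  have h2 : ∀ n, ∫ q, h q.1 * f q.2 ∂(M (g n) : Measure (Sq × Z))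
      = ∫ p, h p * ∫ z, f z ∂(U (g n) p) := fun n =>
    (hU (g n)).isSubKernel.integral_compProd_mul h f
  have h3 : ∫ q, h q.1 * f q.2 ∂(Q : Measure (Sq × Z)) = ∫ p, h p * ∫ z, f z ∂(W p) := by
    rw [hdis]
    exact hW.isSubKernel.integral_compProd_mul h f
  rw [← h3]
  simp only [← h2]
  exact h1

/-- Averages of a kernel over the products of the level sets of an integer-valued
function. -/
def stepAlong {Z : Type*} [MeasurableSpace Z] (U : Sq → Measure Z) (i : unitInterval → ℕ) :
    Sq → Measure Z := fun p =>
  (volume (i ⁻¹' {i p.1}) * volume (i ⁻¹' {i p.2}))⁻¹ •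
    kernelInt U ((i ⁻¹' {i p.1}) ×ˢ (i ⁻¹' {i p.2}))

theorem IsSubKernel.stepAlong {Z : Type*} [MeasurableSpace Z] {U : Sq → Measure Z}
    (hU : IsSubKernel U) {i : unitInterval → ℕ} (hi : Measurable i) :
    IsSubKernel (stepAlong U i) := by
  refine ⟨?_, fun p => ?_⟩
  · let F : ℕ × ℕ → Measure Z := fun q => (volume (i ⁻¹' {q.1}) * volume (i ⁻¹' {q.2}))⁻¹ •
      kernelInt U ((i ⁻¹' {q.1}) ×ˢ (i ⁻¹' {q.2}))
    have hF : Measurable F := measurable_of_countable _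
    have hp : Measurable fun p : Sq => (i p.1, i p.2) :=
      (hi.comp measurable_fst).prodMk (hi.comp measurable_snd)
    have h1 : PG.stepAlong U i = F ∘ fun p => (i p.1, i p.2) := rfl
    rw [h1]
    exact hF.comp hp
  · rw [PG.stepAlong, Measure.smul_apply, smul_eq_mul]
    have h1 := hU.kernelInt_univ_le ((i ⁻¹' {i p.1}) ×ˢ (i ⁻¹' {i p.2}))
    rw [Measure.volume_eq_prod, Measure.prod_prod] at h1
    calc _ ≤ (volume (i ⁻¹' {i p.1}) * volume (i ⁻¹' {i p.2}))⁻¹ *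
          (volume (i ⁻¹' {i p.1}) * volume (i ⁻¹' {i p.2})) := by gcongr
      _ ≤ 1 := ENNReal.inv_mul_le_one _

theorem relabel_stepAlong {Z : Type*} [MeasurableSpace Z] {U : Sq → Measure Z}
    (hU : Measurable U) {i : unitInterval → ℕ} (hi : Measurable i)
    {φ : unitInterval → unitInterval} (hφ : IsMP φ) :
    relabel (stepAlong U i) φ = stepAlong (relabel U φ) (i ∘ φ) := by
  have h1 : ∀ a, volume (φ ⁻¹' (i ⁻¹' {a})) = volume (i ⁻¹' {a}) := fun a =>
    hφ.measure_preimage (hi (measurableSet_singleton a)).nullMeasurableSet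
  have h2 : ∀ a b, kernelInt (relabel U φ) ((φ ⁻¹' (i ⁻¹' {a})) ×ˢ (φ ⁻¹' (i ⁻¹' {b})))
      = kernelInt U ((i ⁻¹' {a}) ×ˢ (i ⁻¹' {b})) := fun a b => by
    rw [← kernelInt_relabel hU hφ
      ((hi (measurableSet_singleton a)).prod (hi (measurableSet_singleton b)))]
    congr 1
  funext p
  rw [relabel, stepAlong, stepAlong]
  simp only [Set.preimage_comp, Function.comp_apply, h1, h2]

theorem FinPartition.exists_index (P : FinPartition) :
    ∃ i : unitInterval → ℕ, Measurable i ∧ (∀ x, i x < P.n) ∧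
      ∀ {Z : Type*} [MeasurableSpace Z] (U : Sq → Measure Z), stepping U P = stepAlong U i := by
  have h1 : ∀ x, ∃ a, x ∈ P.part a := fun x => by
    have : x ∈ ⋃ a, P.part a := by rw [P.covers]; trivial
    simpa using this
  choose c hc using h1
  have huniq : ∀ x a, x ∈ P.part a → a = c x := fun x a ha => by
    by_contra hne
    exact Set.disjoint_left.1 (P.disjoint a (c x) hne) ha (hc x)
  have hpre : ∀ a : Fin P.n, (fun x => (c x : ℕ)) ⁻¹' {(a : ℕ)} = P.part a := fun a => by
    ext x
    simp only [Set.mem_preimage, Set.mem_singleton_iff, Fin.val_inj]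
    exact ⟨fun h => h ▸ hc x, fun h => (huniq x a h).symm⟩
  refine ⟨fun x => c x, ?_, fun x => (c x).2, fun {Z} _ U => ?_⟩
  · have hcm : Measurable c := measurable_to_countable' fun a => by
      have h2 : c ⁻¹' {a} = P.part a := by
        rw [← hpre a]; ext x; simp [Fin.ext_iff]
      rw [h2]; exact P.measurableSet a
    exact (measurable_of_countable (fun a : Fin P.n => (a : ℕ))).comp hcm
  · funext p
    simp only [stepAlong, hpre]
    rw [stepping, Finset.sum_eq_single (c p.1), Finset.sum_eq_single (c p.2)]
    · exact Set.indicator_of_mem (Set.mk_mem_prod (hc _) (hc _)) _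
    · intro b _ hb
      exact Set.indicator_of_notMem (fun h => hb (huniq _ _ h.2)) _
    · simp
    · intro a _ ha
      exact Finset.sum_eq_zero fun b _ =>
        Set.indicator_of_notMem (fun h => ha (huniq _ _ h.1)) _
    · simp

theorem WeakTendsto.kernelInt_congr {Z : Type*} [MeasurableSpace Z] [TopologicalSpace Z]
    [OpensMeasurableSpace Z] {U : ℕ → Sq → Measure Z} (hU : ∀ n, IsSubKernel (U n))
    {A : ℕ → Set Sq} {B : Set Sq} (hA : ∀ n, MeasurableSet (A n)) (hB : MeasurableSet B)
    (hAB : ∀ᵐ p : Sq, ∀ᶠ n in atTop, p ∈ A n ↔ p ∈ B) {ν : Measure Z}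
    (h : WeakTendsto (fun n => kernelInt (U n) B) ν) :
    WeakTendsto (fun n => kernelInt (U n) (A n)) ν := by
  intro f
  have hint : ∀ n (C : Set Sq), MeasurableSet C →
      Integrable (C.indicator fun p => ∫ z, f z ∂(U n p)) volume := fun n C hC =>
    ((hU n).integrable_integral f).indicator hC
  have hb : ∀ n (C : Set Sq) p, ‖C.indicator (fun p => ∫ z, f z ∂(U n p)) p‖ ≤ ‖f‖ :=
    fun n C p => (norm_indicator_le_norm_self _ _).trans ((hU n).abs_integral_le f p)
  have h1 : Tendsto (fun n => ∫ p, ((A n).indicator (fun p => ∫ z, f z ∂(U n p)) p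
      - B.indicator (fun p => ∫ z, f z ∂(U n p)) p)) atTop (𝓝 (∫ _ : Sq, (0 : ℝ))) := by
    refine tendsto_integral_of_dominated_convergence (fun _ => ‖f‖ + ‖f‖)
      (fun n => ((hint n _ (hA n)).sub (hint n _ hB)).aestronglyMeasurable)
      (integrable_const _)
      (fun n => Eventually.of_forall fun p =>
        (norm_sub_le _ _).trans (add_le_add (hb _ _ _) (hb _ _ _))) ?_
    filter_upwards [hAB] with p hp
    refine tendsto_const_nhds.congr' ?_
    filter_upwards [hp] with n hn
    by_cases hpB : p ∈ B
    · simp [hn.2 hpB, hpB]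
    · have hpA : p ∉ A n := fun h => hpB (hn.1 h)
      simp [hpA, hpB]
  have h2 := h1.add (h f)
  rw [integral_zero, zero_add] at h2
  refine h2.congr fun n => ?_
  rw [integral_sub (hint n _ (hA n)) (hint n _ hB), integral_indicator (hA n),
    integral_indicator hB, (hU n).integral_kernelInt, (hU n).integral_kernelInt]
  ring

/-- If kernels converge weakly on every measurable set and integer-valued functions
converge almost everywhere, the corresponding averages converge almost everywhere. -/
theorem ae_weakTendsto_stepAlong {Z : Type*} [MeasurableSpace Z] [TopologicalSpace Z]
    [OpensMeasurableSpace Z] {U : ℕ → Sq → Measure Z} (hU : ∀ n, IsSubKernel (U n))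
    {W : Sq → Measure Z}
    (h : ∀ A, MeasurableSet A → WeakTendsto (fun n => kernelInt (U n) A) (kernelInt W A))
    {i : ℕ → unitInterval → ℕ} (hi : ∀ n, Measurable (i n)) {j : unitInterval → ℕ}
    (hj : Measurable j) (hij : ∀ᵐ x : unitInterval, ∀ᶠ n in atTop, i n x = j x) :
    ∀ᵐ p : Sq, WeakTendsto (fun n => stepAlong (U n) (i n) p) (stepAlong W j p) := by
  have hpos : ∀ᵐ x : unitInterval, volume (j ⁻¹' {j x}) ≠ 0 := by
    have h1 : ∀ a, ∀ᵐ x : unitInterval, volume (j ⁻¹' {a}) = 0 → j x ≠ a := fun a => by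
      by_cases ha : volume (j ⁻¹' {a}) = 0
      · filter_upwards [measure_eq_zero_iff_ae_notMem.1 ha] with x hx _
        exact hx
      · exact Eventually.of_forall fun x hx => absurd hx ha
    filter_upwards [ae_all_iff.2 h1] with x hx h0
    exact hx _ h0 rfl
  have hvol : ∀ a, Tendsto (fun n => volume (i n ⁻¹' {a})) atTop (𝓝 (volume (j ⁻¹' {a}))) := by
    intro a
    refine tendsto_measure_of_ae_tendsto_indicator_of_isFiniteMeasure atTop
      (hj (measurableSet_singleton a)) (fun n => hi n (measurableSet_singleton a)) ?_
    filter_upwards [hij] with x hx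
    filter_upwards [hx] with n hn
    simp [hn]
  have hfst : ∀ᵐ p : Sq, (∀ᶠ n in atTop, i n p.1 = j p.1) ∧ volume (j ⁻¹' {j p.1}) ≠ 0 :=
    (measurePreserving_fst (μ := (volume : Measure unitInterval))
      (ν := (volume : Measure unitInterval))).quasiMeasurePreserving.ae (hij.and hpos)
  have hsnd : ∀ᵐ p : Sq, (∀ᶠ n in atTop, i n p.2 = j p.2) ∧ volume (j ⁻¹' {j p.2}) ≠ 0 :=
    (measurePreserving_snd (μ := (volume : Measure unitInterval))
      (ν := (volume : Measure unitInterval))).quasiMeasurePreserving.ae (hij.and hpos)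
  have hmem : ∀ a b, ∀ᵐ p : Sq, ∀ᶠ n in atTop,
      p ∈ (i n ⁻¹' {a}) ×ˢ (i n ⁻¹' {b}) ↔ p ∈ (j ⁻¹' {a}) ×ˢ (j ⁻¹' {b}) := by
    intro a b
    filter_upwards [hfst, hsnd] with p h1 h2
    filter_upwards [h1.1, h2.1] with n hn1 hn2
    simp [Set.mem_prod, hn1, hn2]
  filter_upwards [hfst, hsnd] with p h1 h2 f
  set a := j p.1
  set b := j p.2
  have hms : ∀ (k : unitInterval → ℕ), Measurable k →
      MeasurableSet ((k ⁻¹' {a}) ×ˢ (k ⁻¹' {b})) := fun k hk =>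
    (hk (measurableSet_singleton a)).prod (hk (measurableSet_singleton b))
  have h3 := WeakTendsto.kernelInt_congr hU (fun n => hms _ (hi n)) (hms j hj) (hmem a b)
    (h _ (hms j hj)) f
  have h4 : Tendsto (fun n => (volume (i n ⁻¹' {a}) * volume (i n ⁻¹' {b}))⁻¹) atTop
      (𝓝 (volume (j ⁻¹' {a}) * volume (j ⁻¹' {b}))⁻¹) :=
    (ENNReal.Tendsto.mul (hvol a) (Or.inr (measure_ne_top _ _)) (hvol b)
      (Or.inr (measure_ne_top _ _))).inv
  have h5 := (ENNReal.tendsto_toReal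
    (ENNReal.inv_ne_top.2 (mul_ne_zero h1.2 h2.2))).comp h4
  have h6 := h5.mul h3
  have h7 : ∫ z, f z ∂(stepAlong W j p) = (volume (j ⁻¹' {a}) * volume (j ⁻¹' {b}))⁻¹.toReal *
      ∫ z, f z ∂(kernelInt W ((j ⁻¹' {a}) ×ˢ (j ⁻¹' {b}))) := by
    rw [stepAlong, integral_smul_measure, smul_eq_mul]
  rw [h7]
  refine h6.congr' ?_
  filter_upwards [h1.1, h2.1] with n hn1 hn2
  rw [stepAlong, integral_smul_measure, smul_eq_mul, hn1, hn2]
  rfl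

/-- Almost everywhere weak convergence of kernels implies convergence, uniformly over all
subsets of the square, of the integrated kernels. -/
theorem eventually_forall_dm_kernelInt_le {Z : Type*} [MeasurableSpace Z] [TopologicalSpace Z]
    [PolishSpace Z] [BorelSpace Z] {dm : Measure Z → Measure Z → ℝ}
    (hdm : IsDistOnSubProb dm) (hweak : InducesWeakTopologySub dm)
    {V : ℕ → Sq → Measure Z} {W : Sq → Measure Z} (hV : ∀ n, IsSubKernel (V n))
    (hW : IsSubKernel W) (h : ∀ᵐ p : Sq, WeakTendsto (fun n => V n p) (W p)) {ε : ℝ}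
    (hε : 0 < ε) :
    ∀ᶠ n in atTop, ∀ A, MeasurableSet A → dm (kernelInt (V n) A) (kernelInt W A) ≤ ε := by
  have key : ∀ A : ℕ → Set Sq, (∀ n, MeasurableSet (A n)) →
      Tendsto (fun n => dm (kernelInt W (A n)) (kernelInt (V n) (A n))) atTop (𝓝 0) := by
    intro A hA
    have hfin : IsFiniteMeasure (MW W) := by
      rw [MW_eq_kernelInt]; exact isFiniteMeasure_of_mem_subProb (hW.kernelInt_mem _)
    refine tendsto_dm_of_tendsto_integral_sub hdm hweak
      (fun n => kernelInt_le_MW hW.meas (A n)) (fun n => hW.kernelInt_mem _)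
      (fun n => (hV n).kernelInt_mem _) fun f => ?_
    have h1 : Tendsto (fun n => ∫ p, |∫ z, f z ∂(W p) - ∫ z, f z ∂(V n p)|) atTop
        (𝓝 (∫ _ : Sq, (0 : ℝ))) := by
      refine tendsto_integral_of_dominated_convergence (fun _ => ‖f‖ + ‖f‖)
        (fun n => ((hW.integrable_integral f).sub
          ((hV n).integrable_integral f)).abs.aestronglyMeasurable)
        (integrable_const _) (fun n => Eventually.of_forall fun p => ?_) ?_
      · rw [Real.norm_eq_abs, abs_abs]
        exact (abs_sub _ _).trans
          (add_le_add (hW.abs_integral_le f p) ((hV n).abs_integral_le f p))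
      · filter_upwards [h] with p hp
        have := (tendsto_const_nhds (x := ∫ z, f z ∂(W p))).sub (hp f)
        rw [sub_self] at this
        simpa using this.abs
    rw [integral_zero] at h1
    refine squeeze_zero_norm (fun n => ?_) h1
    rw [hW.integral_kernelInt, (hV n).integral_kernelInt,
      ← integral_sub (hW.integrable_integral f) ((hV n).integrable_integral f)]
    refine (norm_integral_le_integral_norm _).trans ?_
    exact setIntegral_le_integral
      ((hW.integrable_integral f).sub ((hV n).integrable_integral f)).norm
      (Eventually.of_forall fun p => norm_nonneg _)
  have hex : ∀ n, ∃ A, MeasurableSet A ∧ ((∃ B, MeasurableSet B ∧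
      ε < dm (kernelInt W B) (kernelInt (V n) B)) →
        ε < dm (kernelInt W A) (kernelInt (V n) A)) := by
    intro n
    by_cases hB : ∃ B, MeasurableSet B ∧ ε < dm (kernelInt W B) (kernelInt (V n) B)
    · obtain ⟨B, hB1, hB2⟩ := hB
      exact ⟨B, hB1, fun _ => hB2⟩
    · exact ⟨∅, MeasurableSet.empty, fun h => absurd h hB⟩
  choose A hA hAε using hex
  filter_upwards [(key A hA).eventually (gt_mem_nhds hε)] with n hn B hB
  rw [hdm.1 _ ((hV n).kernelInt_mem _) _ (hW.kernelInt_mem _)]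
  by_contra hcon
  exact absurd (hAε n ⟨B, hB, not_le.1 hcon⟩) (not_lt.2 hn.le)

theorem kernelInt_relabel_prod {Z : Type*} [MeasurableSpace Z] {W : Sq → Measure Z}
    (hW : Measurable W) {φ : unitInterval → unitInterval} (hφ : IsMP φ)
    {S T : Set unitInterval} (hS : MeasurableSet S) (hT : MeasurableSet T) :
    kernelInt (relabel W φ) ((φ ⁻¹' S) ×ˢ (φ ⁻¹' T)) = kernelInt W (S ×ˢ T) := by
  rw [← kernelInt_relabel hW hφ (hS.prod hT)]
  congr 1

theorem dm_relabel_le_cutDist {Z : Type*} [MeasurableSpace Z] [TopologicalSpace Z]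
    [PolishSpace Z] [BorelSpace Z] {dm : Measure Z → Measure Z → ℝ}
    (hdm : IsDistOnSubProb dm) (hweak : InducesWeakTopologySub dm)
    {U W : Sq → Measure Z} (hU : IsSubKernel U) (hW : IsSubKernel W)
    {φ : unitInterval → unitInterval} (hφ : IsMP φ) (hbij : Function.Bijective φ)
    {S T : Set unitInterval} (hS : MeasurableSet S) (hT : MeasurableSet T) :
    dm (kernelInt (relabel U φ) (S ×ˢ T)) (kernelInt (relabel W φ) (S ×ˢ T))
      ≤ cutDist dm U W := by
  obtain ⟨ψ, hψ, -, hψφ, -⟩ := hφ.exists_inverse hbij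
  have hpre : ∀ R : Set unitInterval, φ ⁻¹' (ψ ⁻¹' R) = R := fun R => by
    ext x; simp [hψφ]
  have h := fun (V : Sq → Measure Z) (hV : Measurable V) =>
    kernelInt_relabel_prod hV hφ (hψ.measurable hS) (hψ.measurable hT)
  simp only [hpre] at h
  rw [h U hU.meas, h W hW.meas]
  exact dm_le_cutDist hdm hweak hU hW (hψ.measurable hS) (hψ.measurable hT)

theorem deltaCut_le_of_forall_dm_relabel_le {Z : Type*} [MeasurableSpace Z]
    {dm : Measure Z → Measure Z → ℝ} (hdm : IsDistOnSubProb dm) {U W : Sq → Measure Z}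
    (hU : IsSubKernel U) (hW : IsSubKernel W) {φ : unitInterval → unitInterval} (hφ : IsMP φ)
    (hbij : Function.Bijective φ) {ε : ℝ} (hε : 0 ≤ ε)
    (h : ∀ S T : Set unitInterval, MeasurableSet S → MeasurableSet T →
      dm (kernelInt (relabel U φ) (S ×ˢ T)) (kernelInt W (S ×ˢ T)) ≤ ε) :
    deltaCut (cutDist dm) U W ≤ ε := by
  obtain ⟨ψ, hψ, hψb, hψφ, -⟩ := hφ.exists_inverse hbij
  refine (deltaCut_le hdm hU hW hψ hψb).trans (Real.iSup_le (fun ST => ?_) hε)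
  obtain ⟨⟨S, T⟩, hS, hT⟩ := ST
  have h1 : relabel (relabel W ψ) φ = W := by
    funext p
    simp only [relabel, hψφ]
  have h2 := kernelInt_relabel_prod (hW.relabel hψ).meas hφ hS hT
  rw [h1] at h2
  simp only [← h2, ← kernelInt_relabel_prod hU.meas hφ hS hT]
  exact h _ _ (hφ.measurable hS) (hφ.measurable hT)

/-- If kernels converge weakly on measurable sets and are uniformly well approximated, in
the cut sense, by averages over converging partitions, then they converge uniformly on
measurable rectangles. -/
theorem eventually_forall_dm_le_of_stepAlong {Z : Type*} [MeasurableSpace Z]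
    [TopologicalSpace Z] [PolishSpace Z] [BorelSpace Z] {dm : Measure Z → Measure Z → ℝ}
    (hdm : IsDistOnSubProb dm) (hweak : InducesWeakTopologySub dm)
    {U : ℕ → Sq → Measure Z} {W : Sq → Measure Z} (hU : ∀ n, IsSubKernel (U n))
    (hW : IsSubKernel W)
    (h : ∀ A, MeasurableSet A → WeakTendsto (fun n => kernelInt (U n) A) (kernelInt W A))
    {i : ℕ → unitInterval → ℕ} (hi : ∀ n, Measurable (i n))
    (hij : ∀ᵐ x : unitInterval, ∃ l, ∀ᶠ n in atTop, i n x = l) {ε : ℝ} (hε : 0 < ε)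
    (hstep : ∀ n (S T : Set unitInterval), MeasurableSet S → MeasurableSet T →
      dm (kernelInt (U n) (S ×ˢ T)) (kernelInt (stepAlong (U n) (i n)) (S ×ˢ T)) ≤ ε) :
    ∀ᶠ n in atTop, ∀ S T : Set unitInterval, MeasurableSet S → MeasurableSet T →
      dm (kernelInt (U n) (S ×ˢ T)) (kernelInt W (S ×ˢ T)) ≤ 5 * ε := by
  obtain ⟨j, hj, hlim⟩ := measurable_limit_of_tendsto_metrizable_ae
    (μ := (volume : Measure unitInterval)) (L := atTop) (fun n => (hi n).aemeasurable) (by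
      filter_upwards [hij] with x ⟨l, hl⟩
      exact ⟨l, tendsto_const_nhds.congr' (hl.mono fun n hn => hn.symm)⟩)
  have hlim' : ∀ᵐ x : unitInterval, ∀ᶠ n in atTop, i n x = j x := by
    filter_upwards [hlim] with x hx
    rwa [nhds_discrete, tendsto_pure] at hx
  have hVn : ∀ n, IsSubKernel (stepAlong (U n) (i n)) := fun n => (hU n).stepAlong (hi n)
  have hV : IsSubKernel (stepAlong W j) := hW.stepAlong hj
  have hev := eventually_forall_dm_kernelInt_le hdm hweak hVn hV
    (ae_weakTendsto_stepAlong hU h hi hj hlim') hε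
  have hlimit : ∀ S T : Set unitInterval, MeasurableSet S → MeasurableSet T →
      dm (kernelInt (stepAlong W j) (S ×ˢ T)) (kernelInt W (S ×ˢ T)) ≤ 3 * ε := by
    intro S T hS hT
    have h1 := (hweak _ _ (fun n => (hU n).kernelInt_mem _) (hW.kernelInt_mem _)).2
      (h (S ×ˢ T) (hS.prod hT))
    obtain ⟨n, hn1, hn2⟩ := (hev.and (h1.eventually (gt_mem_nhds hε))).exists
    have h2 := hn1 _ (hS.prod hT)
    rw [hdm.1 _ ((hVn n).kernelInt_mem _) _ (hV.kernelInt_mem _)] at h2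
    have h3 := hstep n S T hS hT
    rw [hdm.1 _ ((hU n).kernelInt_mem _) _ ((hVn n).kernelInt_mem _)] at h3
    have h4 := hdm.2.2.1 _ (hV.kernelInt_mem (S ×ˢ T)) _ ((hVn n).kernelInt_mem (S ×ˢ T)) _
      (hW.kernelInt_mem (S ×ˢ T))
    have h5 := hdm.2.2.1 _ ((hVn n).kernelInt_mem (S ×ˢ T)) _ ((hU n).kernelInt_mem (S ×ˢ T)) _
      (hW.kernelInt_mem (S ×ˢ T))
    linarith
  filter_upwards [hev] with n hn S T hS hT
  have h1 := hn _ (hS.prod hT)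
  have h2 := hstep n S T hS hT
  have h3 := hlimit S T hS hT
  have h4 := hdm.2.2.1 _ ((hU n).kernelInt_mem (S ×ˢ T)) _ ((hVn n).kernelInt_mem (S ×ˢ T)) _
    (hW.kernelInt_mem (S ×ˢ T))
  have h5 := hdm.2.2.1 _ ((hVn n).kernelInt_mem (S ×ˢ T)) _ (hV.kernelInt_mem (S ×ˢ T)) _
    (hW.kernelInt_mem (S ×ˢ T))
  linarith

/-- Every sequence in a tight set of probability-graphons has a subsequence converging for
the unlabeled cut distance, provided the cut distance is weakly regular. -/
theorem TightFamily.exists_subseq_tendsto_deltaCut {Z : Type*} [MeasurableSpace Z]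
    [TopologicalSpace Z] [PolishSpace Z] [BorelSpace Z] {dm : Measure Z → Measure Z → ℝ}
    (hdm : IsDistOnSubProb dm) (hweak : InducesWeakTopologySub dm)
    (hreg : WeaklyRegular (cutDist dm)) {K : Set (Sq → Measure Z)}
    (hT : TightFamily K) (hK : ∀ W ∈ K, IsProbGraphon W)
    {Wn : ℕ → Sq → Measure Z} (hWn : ∀ n, Wn n ∈ K) :
    ∃ (g : ℕ → ℕ) (W : Sq → Measure Z), StrictMono g ∧ IsProbGraphon W ∧
      Tendsto (fun n => deltaCut (cutDist dm) (Wn (g n)) W) atTop (𝓝 0) := by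
  have hWp : ∀ n, IsProbGraphon (Wn n) := fun n => hK _ (hWn n)
  have hidx : ∀ k : ℕ, ∃ m : ℕ, ∀ n, ∃ i : unitInterval → ℕ, Measurable i ∧ (∀ x, i x < m) ∧
      cutDist dm (Wn n) (stepAlong (Wn n) i) ≤ 1 / ((k : ℝ) + 1) := by
    intro k
    obtain ⟨m, -, hm⟩ := hreg K hK hT (1 / ((k : ℝ) + 1)) Nat.one_div_pos_of_nat
    refine ⟨m, fun n => ?_⟩
    obtain ⟨P, -, hPn, hP⟩ := hm _ (hWn n)
      ⟨1, fun _ => Set.univ, fun _ => MeasurableSet.univ,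
        fun i j hij => absurd (Subsingleton.elim i j) hij, Set.iUnion_const _⟩
    obtain ⟨i, hi, hlt, hstep⟩ := P.exists_index
    refine ⟨i, hi, fun x => (hlt x).trans_le (by simpa using hPn), ?_⟩
    rw [← hstep]
    exact hP.le
  choose m idx hmeas hlt hcut using hidx
  obtain ⟨φ, g₁, hφ, hbij, hg₁, hconst⟩ := exists_isMP_ae_eventually_const hmeas hlt
  have hTU : TightFamily (Set.range fun n => relabel (Wn (g₁ n)) (φ (g₁ n))) := by
    intro ε hε
    obtain ⟨K₀, hK₀, hle⟩ := hT ε hε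
    refine ⟨K₀, hK₀, ?_⟩
    rintro _ ⟨n, rfl⟩
    rw [MW_relabel (hWp _).isSubKernel.meas (hφ _)]
    exact hle _ (hWn _)
  obtain ⟨g₂, W, hg₂, hW, hlim⟩ := exists_subseq_weakTendsto_kernelInt
    (fun n => (hWp (g₁ n)).relabel (hφ (g₁ n))) hTU
  refine ⟨fun n => g₁ (g₂ n), W, hg₁.comp hg₂, hW, ?_⟩
  rw [Metric.tendsto_atTop']
  intro ε hε
  obtain ⟨k, hk⟩ := exists_nat_one_div_lt (show 0 < ε / 5 by positivity)
  have hsub : ∀ n, IsSubKernel (Wn n) := fun n => (hWp n).isSubKernel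
  have hstep : ∀ n (S T : Set unitInterval), MeasurableSet S → MeasurableSet T →
      dm (kernelInt (relabel (Wn n) (φ n)) (S ×ˢ T))
        (kernelInt (stepAlong (relabel (Wn n) (φ n)) (idx k n ∘ φ n)) (S ×ˢ T))
          ≤ 1 / ((k : ℝ) + 1) := by
    intro n S T hS hT
    rw [← relabel_stepAlong (hsub n).meas (hmeas k n) (hφ n)]
    exact (dm_relabel_le_cutDist hdm hweak (hsub n) ((hsub n).stepAlong (hmeas k n)) (hφ n)
      (hbij n) hS hT).trans (hcut k n)
  have hev := eventually_forall_dm_le_of_stepAlong hdm hweak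
    (fun n => (hsub (g₁ (g₂ n))).relabel (hφ (g₁ (g₂ n)))) hW.isSubKernel hlim
    (i := fun n => idx k (g₁ (g₂ n)) ∘ φ (g₁ (g₂ n)))
    (fun n => (hmeas k _).comp (hφ _).measurable) (by
      filter_upwards [hconst k] with x ⟨l, hl⟩
      exact ⟨l, hg₂.tendsto_atTop.eventually hl⟩)
    (ε := 1 / ((k : ℝ) + 1)) Nat.one_div_pos_of_nat (fun n => hstep _)
  obtain ⟨N, hN⟩ := eventually_atTop.1 hev
  refine ⟨N, fun n hn => ?_⟩
  have h1 := deltaCut_le_of_forall_dm_relabel_le hdm (hsub (g₁ (g₂ n))) hW.isSubKernel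
    (hφ _) (hbij _) (by positivity) (hN n (le_of_lt hn))
  rw [Real.dist_eq, sub_zero, abs_of_nonneg (deltaCut_nonneg hdm (hsub _) hW.isSubKernel)]
  linarith

/-- **Characterization of relative compactness.**
Let `d_m` be a distance on `ℳ≤1(Z)` inducing the weak topology on `ℳ≤1(Z)` and such
that the cut distance `d_{□,m}` on `𝒲₁` is smooth and weakly regular.  Then:
(i) every sequence of probability-graphons converging for `δ_{□,m}` is tight;
(ii) a subset `K` of `𝒲̃₁` is relatively compact for `δ_{□,m}` (equivalently, since
`δ_{□,m}` is a metric on the quotient `𝒲̃₁`: every sequence in `K` admits a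
subsequence converging for `δ_{□,m}` to some probability-graphon) if and only if `K`
is tight. -/
theorem relative_compactness_iff_tight
    {Z : Type*} [MeasurableSpace Z] [TopologicalSpace Z] [PolishSpace Z] [BorelSpace Z]
    (dm : Measure Z → Measure Z → ℝ)
    (hdm : IsDistOnSubProb dm) (hweak : InducesWeakTopologySub dm)
    (hsmooth : Smooth (cutDist dm)) (hreg : WeaklyRegular (cutDist dm)) :
    (∀ (Wn : ℕ → Sq → Measure Z) (W : Sq → Measure Z),
      (∀ n, IsProbGraphon (Wn n)) → IsProbGraphon W →
      Tendsto (fun n => deltaCut (cutDist dm) (Wn n) W) atTop (𝓝 0) →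
      TightFamily (Set.range Wn)) ∧
    (∀ K : Set (Sq → Measure Z), (∀ W ∈ K, IsProbGraphon W) →
      (TightFamily K ↔
        ∀ Wn : ℕ → Sq → Measure Z, (∀ n, Wn n ∈ K) →
          ∃ (g : ℕ → ℕ) (W : Sq → Measure Z), StrictMono g ∧ IsProbGraphon W ∧
            Tendsto (fun ℓ => deltaCut (cutDist dm) (Wn (g ℓ)) W) atTop (𝓝 0))) := by
  refine ⟨fun Wn W hWn hW h => ?_, fun K hK => ⟨fun hT Wn hWn => ?_, fun h => ?_⟩⟩
  · exact tightFamily_range_of_tendsto hWn hW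
      (weakTendsto_MW hdm hweak (fun n => (hWn n).isSubKernel) hW.isSubKernel h)
  · exact hT.exists_subseq_tendsto_deltaCut hdm hweak hreg hK hWn
  · refine tightFamily_of_subseq hK fun Wn hWn => ?_
    obtain ⟨g, W, hg, hW, hlim⟩ := h Wn hWn
    exact ⟨g, W, hg, hW, weakTendsto_MW hdm hweak
      (fun n => (hK _ (hWn (g n))).isSubKernel) hW.isSubKernel hlim⟩

end PG
end
end

section
/- Alternative tightness criterion: let K be a uniformly bounded set of signed measure-valued kernels. Then K is tight if and only if for every ε > 0 there exists a compact set K₀ ⊆ Z such that for every W ∈ K, λ₂({(x,y) ∈ [0,1]² : |W|(x,y; Z∖K₀) ≤ ε}) > 1 − ε, where λ₂ is the Lebesgue measure on [0,1]². -/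
open MeasureTheory Filter Topology
open scoped ENNReal NNReal

noncomputable section

namespace PG

variable {Z : Type*} [MeasurableSpace Z] [TopologicalSpace Z]

/-- The positive part of a signed measure is the supremum, over any algebra of sets generating
the `σ`-algebra, of the values of the signed measure on traces. -/
lemma posPart_apply_eq_iSup {α : Type*} [m : MeasurableSpace α] {𝒜 : Set (Set α)}
    (h𝒜 : IsSetAlgebra 𝒜) (hgen : m = MeasurableSpace.generateFrom 𝒜)
    (s : SignedMeasure α) {A : Set α} (hA : MeasurableSet A) :
    s.toJordanDecomposition.posPart A = ⨆ B ∈ 𝒜, ENNReal.ofReal (s (A ∩ B)) := by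
  have h𝒜m : ∀ B ∈ 𝒜, MeasurableSet B := fun B hB =>
    hgen ▸ MeasurableSpace.measurableSet_generateFrom hB
  have hs : ∀ B, MeasurableSet B → s B = s.toJordanDecomposition.posPart.real B
      - s.toJordanDecomposition.negPart.real B :=
    fun B hB => s.apply_eq_posPart_real_sub_negPart_real hB
  apply le_antisymm
  · obtain ⟨i, hi, hi₂, -, hpos, -⟩ := s.toJordanDecomposition_spec
    have hval : s.toJordanDecomposition.posPart.real A = s (i ∩ A) := by
      rw [hpos, SignedMeasure.toMeasureOfZeroLE_real_apply s hi₂ hi hA]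
    refine ENNReal.le_of_forall_pos_le_add fun ε hε _ => ?_
    have hdense := Measure.MeasureDense.of_generateFrom_isSetAlgebra_finite
      (s.toJordanDecomposition.posPart + s.toJordanDecomposition.negPart) h𝒜 hgen
    obtain ⟨B, hB, hiB⟩ := hdense.approx i hi (measure_ne_top _ _) ε (by exact_mod_cast hε)
    have hBm := h𝒜m B hB
    have hsmall : s.toJordanDecomposition.posPart.real (symmDiff i B)
        + s.toJordanDecomposition.negPart.real (symmDiff i B) < ε := by
      rw [← measureReal_add_apply, measureReal_def]
      exact (ENNReal.lt_ofReal_iff_toReal_lt (measure_ne_top _ _)).1 hiB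
    have hp : s.toJordanDecomposition.posPart.real (i ∩ A)
        ≤ s.toJordanDecomposition.posPart.real (A ∩ B)
          + s.toJordanDecomposition.posPart.real (symmDiff i B) := by
      refine (measureReal_mono ?_).trans (measureReal_union_le _ _)
      intro x hx
      by_cases hxB : x ∈ B
      · exact Or.inl ⟨hx.2, hxB⟩
      · exact Or.inr (Or.inl ⟨hx.1, hxB⟩)
    have hn : s.toJordanDecomposition.negPart.real (A ∩ B)
        ≤ s.toJordanDecomposition.negPart.real (i ∩ A)
          + s.toJordanDecomposition.negPart.real (symmDiff i B) := by
      refine (measureReal_mono ?_).trans (measureReal_union_le _ _)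
      intro x hx
      by_cases hxi : x ∈ i
      · exact Or.inl ⟨hxi, hx.1⟩
      · exact Or.inr (Or.inr ⟨hx.2, hxi⟩)
    have hle : s.toJordanDecomposition.posPart.real A ≤ s (A ∩ B) + ε := by
      rw [hval, hs _ (hi.inter hA), hs _ (hA.inter hBm)]
      linarith
    calc s.toJordanDecomposition.posPart A
        = ENNReal.ofReal (s.toJordanDecomposition.posPart.real A) :=
          (ofReal_measureReal).symm
      _ ≤ ENNReal.ofReal (s (A ∩ B) + ε) := ENNReal.ofReal_le_ofReal hle
      _ ≤ ENNReal.ofReal (s (A ∩ B)) + ENNReal.ofReal ε := ENNReal.ofReal_add_le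
      _ ≤ (⨆ B ∈ 𝒜, ENNReal.ofReal (s (A ∩ B))) + ε := by
          rw [ENNReal.ofReal_coe_nnreal]
          gcongr
          exact le_iSup₂_of_le B hB le_rfl
  · refine iSup₂_le fun B hB => ?_
    rw [hs _ (hA.inter (h𝒜m B hB))]
    refine (ENNReal.ofReal_le_ofReal (sub_le_self _ measureReal_nonneg)).trans ?_
    rw [ofReal_measureReal]
    exact measure_mono Set.inter_subset_left

section Measurability

variable {α β : Type*} [MeasurableSpace α] [MeasurableSpace β]
  [MeasurableSpace.CountablyGenerated α] {W : β → SignedMeasure α}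

lemma measurable_posPart_apply
    (hW : ∀ A : Set α, MeasurableSet A → Measurable fun p => W p A)
    {A : Set α} (hA : MeasurableSet A) :
    Measurable fun p => (W p).toJordanDecomposition.posPart A := by
  obtain ⟨S, hS, hgen⟩ := MeasurableSpace.CountablyGenerated.isCountablyGenerated (α := α)
  have hgen' := hgen.trans (generateFrom_generateSetAlgebra_eq (𝒜 := S)).symm
  simp_rw [posPart_apply_eq_iSup isSetAlgebra_generateSetAlgebra hgen' _ hA]
  refine Measurable.biSup _ (countable_generateSetAlgebra hS) fun B hB => ?_
  have hBm : MeasurableSet B := by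
    rw [hgen']
    exact MeasurableSpace.measurableSet_generateFrom hB
  exact (hW _ (hA.inter hBm)).ennreal_ofReal

lemma measurable_totalVariation_apply
    (hW : ∀ A : Set α, MeasurableSet A → Measurable fun p => W p A)
    {A : Set α} (hA : MeasurableSet A) :
    Measurable fun p => (W p).totalVariation A := by
  have hneg : Measurable fun p => (W p).toJordanDecomposition.negPart A := by
    have h := measurable_posPart_apply (W := fun p => -W p) (fun B hB => (hW B hB).neg) hA
    simpa only [SignedMeasure.toJordanDecomposition_neg, JordanDecomposition.neg_posPart] using h
  exact (measurable_posPart_apply hW hA).add hneg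

end Measurability

section ProbabilityBounds

variable {Ω : Type*} [MeasurableSpace Ω] {P : Measure Ω} [IsProbabilityMeasure P]
  {f : Ω → ℝ≥0∞}

/-- Markov's inequality in the form of a lower bound on the measure of a sublevel set. -/
lemma ofReal_one_sub_lt_measure_le (hf : Measurable f) {ε : ℝ} (hε : 0 < ε)
    (h : ∫⁻ x, f x ∂P ≤ ENNReal.ofReal (ε * (min ε 1 / 2))) :
    ENNReal.ofReal (1 - ε) < P {x | f x ≤ ENNReal.ofReal ε} := by
  have hη : 0 < min ε 1 / 2 := by positivity
  have hset : {x | f x ≤ ENNReal.ofReal ε} = {x | ENNReal.ofReal ε < f x}ᶜ := by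
    ext x
    simp
  have hbad : P {x | ENNReal.ofReal ε < f x} ≤ ENNReal.ofReal (min ε 1 / 2) := by
    have hsub : {x | ENNReal.ofReal ε < f x} ⊆ {x | ENNReal.ofReal ε ≤ f x} :=
      Set.ofPred_subset_ofPred.2 fun _ hx => hx.le
    refine (measure_mono hsub).trans
      ((meas_ge_le_lintegral_div hf.aemeasurable
        (ENNReal.ofReal_pos.2 hε).ne' ENNReal.ofReal_ne_top).trans ?_)
    refine ENNReal.div_le_of_le_mul ?_
    rw [← ENNReal.ofReal_mul hη.le, mul_comm]
    exact h
  rw [hset, prob_compl_eq_one_sub (measurableSet_lt measurable_const hf)]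
  refine lt_of_lt_of_le ?_ (tsub_le_tsub_left hbad 1)
  rw [← ENNReal.ofReal_one, ← ENNReal.ofReal_sub _ hη.le,
    ENNReal.ofReal_lt_ofReal_iff (by linarith [min_le_right ε 1])]
  linarith [min_le_left ε 1]

lemma lintegral_le_of_ofReal_one_sub_lt_measure_le (hf : Measurable f) {C : ℝ≥0∞}
    (hC : ∀ᵐ x ∂P, f x ≤ C) {δ : ℝ}
    (h : ENNReal.ofReal (1 - δ) < P {x | f x ≤ ENNReal.ofReal δ}) :
    ∫⁻ x, f x ∂P ≤ (1 + C) * ENNReal.ofReal δ := by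
  have hmeas : MeasurableSet {x | f x ≤ ENNReal.ofReal δ} :=
    measurableSet_le hf measurable_const
  have hbad : P {x | f x ≤ ENNReal.ofReal δ}ᶜ ≤ ENNReal.ofReal δ := by
    rw [prob_compl_eq_one_sub hmeas]
    refine (tsub_le_tsub_left h.le 1).trans ?_
    rw [tsub_le_iff_right, ← ENNReal.ofReal_one]
    calc ENNReal.ofReal 1 = ENNReal.ofReal (δ + (1 - δ)) := by ring_nf
      _ ≤ _ := ENNReal.ofReal_add_le
  rw [← lintegral_add_compl f hmeas, add_mul, one_mul]
  refine add_le_add ?_ ?_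
  · calc ∫⁻ x in {x | f x ≤ ENNReal.ofReal δ}, f x ∂P
        ≤ ∫⁻ _ in {x | f x ≤ ENNReal.ofReal δ}, ENNReal.ofReal δ ∂P :=
          setLIntegral_mono' hmeas fun x hx => hx
      _ ≤ ENNReal.ofReal δ := by
          rw [setLIntegral_const]
          exact mul_le_of_le_one_right' prob_le_one
  · calc ∫⁻ x in {x | f x ≤ ENNReal.ofReal δ}ᶜ, f x ∂P
        ≤ ∫⁻ _ in {x | f x ≤ ENNReal.ofReal δ}ᶜ, C ∂P :=
          lintegral_mono_ae (ae_restrict_of_ae hC)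
      _ ≤ C * ENNReal.ofReal δ := by
          rw [setLIntegral_const]
          gcongr

end ProbabilityBounds

/-- **Alternative tightness criterion.**
Let `K` be a uniformly bounded set of signed measure-valued kernels.  Then `K` is
tight if and only if for every `ε > 0` there exists a compact set `K₀ ⊆ Z` such that
for every `W ∈ K`,
`λ₂({(x,y) ∈ [0,1]² : |W|(x,y; Z∖K₀) ≤ ε}) > 1 − ε`. -/
theorem alternative_tightness_criterion
    {Z : Type*} [MeasurableSpace Z] [TopologicalSpace Z] [PolishSpace Z] [BorelSpace Z]
    (K : Set (Sq → SignedMeasure Z))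
    (hker : ∀ W ∈ K, IsSignedKernel W)
    (hbdd : ∃ C : ℝ≥0∞, C < ⊤ ∧ ∀ W ∈ K, TVbound W ≤ C) :
    TightFamilyS K ↔
      ∀ ε : ℝ, 0 < ε → ∃ K₀ : Set Z, IsCompact K₀ ∧ ∀ W ∈ K,
        ENNReal.ofReal (1 - ε) <
          (volume : Measure Sq)
            {p | (W p).totalVariation K₀ᶜ ≤ ENNReal.ofReal ε} := by
  obtain ⟨C, hC, hKC⟩ := hbdd
  have hmeas : ∀ W ∈ K, ∀ K₀ : Set Z, IsCompact K₀ →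
      Measurable fun p => (W p).totalVariation K₀ᶜ := fun W hW K₀ hK₀ =>
    measurable_totalVariation_apply (hker W hW).1 hK₀.measurableSet.compl
  have hMWs : ∀ W ∈ K, ∀ K₀ : Set Z, IsCompact K₀ →
      MWs W K₀ᶜ = ∫⁻ p, (W p).totalVariation K₀ᶜ ∂(volume : Measure Sq) := fun W hW K₀ hK₀ =>
    Measure.bind_apply hK₀.measurableSet.compl
      (Measure.measurable_of_measurable_coe _ fun _ hA =>
        measurable_totalVariation_apply (hker W hW).1 hA).aemeasurable
  constructor
  · intro h ε hε
    obtain ⟨K₀, hK₀, hle⟩ := h (ENNReal.ofReal (ε * (min ε 1 / 2)))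
      (ENNReal.ofReal_pos.2 (by positivity))
    refine ⟨K₀, hK₀, fun W hW => ofReal_one_sub_lt_measure_le (hmeas W hW K₀ hK₀) hε ?_⟩
    rw [← hMWs W hW K₀ hK₀]
    exact hle W hW
  · intro h ε hε
    have hC' : 1 + C ≠ ⊤ := ENNReal.add_ne_top.2 ⟨ENNReal.one_ne_top, hC.ne⟩
    obtain ⟨δ, hδ, hδε⟩ := ENNReal.exists_nnreal_pos_mul_lt hC' hε.ne'
    obtain ⟨K₀, hK₀, hlt⟩ := h δ (by exact_mod_cast hδ)
    refine ⟨K₀, hK₀, fun W hW => ?_⟩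
    have hae : ∀ᵐ p ∂(volume : Measure Sq), (W p).totalVariation K₀ᶜ ≤ C := by
      filter_upwards [ENNReal.ae_le_essSup fun p => TVnorm (W p)] with p hp
      exact (measure_mono (Set.subset_univ _)).trans (hp.trans (hKC W hW))
    rw [hMWs W hW K₀ hK₀]
    refine (lintegral_le_of_ofReal_one_sub_lt_measure_le (hmeas W hW K₀ hK₀) hae
      (hlt W hW)).trans ?_
    rw [ENNReal.ofReal_coe_nnreal, mul_comm]
    exact hδε.le

end PG
end
end

section
/- Combinatorial optimization of the cut distance for stepfunctions: let d_m be a quasi-convex distance on a convex subset ℳ of ℳ±(Z) containing the zero measure. Let U, W be ℳ-valued stepfunction kernels adapted to the same finite measurable partition 𝒫 of [0,1]. Then there exist sets S, T in the σ-field σ(𝒫) generated by 𝒫 (i.e. finite unions of classes of 𝒫) such that d_{□,m}(U, W) = d_m(U(S×T;·), W(S×T;·)); in particular the supremum in the definition of d_{□,m}(U,W) is attained. -/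
open MeasureTheory Filter Topology
open scoped ENNReal NNReal

noncomputable section

namespace PG

variable {Z : Type*} [MeasurableSpace Z] [TopologicalSpace Z]

/-! ### Vertices of a box and convexity -/

/-- If replacing a coordinate of `a` by the better of the two endpoints never decreases `f`,
then on the box `∏ [0, L i]` the function `f` is bounded by its value at some vertex. -/
theorem exists_vertex_ge {ι : Type*} [Fintype ι] [DecidableEq ι] (f : (ι → ℝ) → ℝ) (L : ι → ℝ)
    (hL : 0 ≤ L)
    (hf : ∀ a, 0 ≤ a → a ≤ L → ∀ i,
      f a ≤ max (f (Function.update a i (L i))) (f (Function.update a i 0)))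
    (a : ι → ℝ) (ha : 0 ≤ a) (haL : a ≤ L) :
    ∃ I : Finset ι, f a ≤ f fun i => if i ∈ I then L i else 0 := by
  have key : ∀ K : Finset ι, ∃ a' : ι → ℝ, 0 ≤ a' ∧ a' ≤ L ∧
      (∀ i ∈ K, a' i = L i ∨ a' i = 0) ∧ f a ≤ f a' := by
    intro K
    induction K using Finset.induction_on with
    | empty => exact ⟨a, ha, haL, by simp, le_rfl⟩
    | insert i K _ ih =>
      obtain ⟨a', h0, h1, hK, hle⟩ := ih
      have upd : ∀ c, 0 ≤ c → c ≤ L i → (c = L i ∨ c = 0) →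
          f a ≤ f (Function.update a' i c) →
          ∃ a' : ι → ℝ, 0 ≤ a' ∧ a' ≤ L ∧
            (∀ j ∈ insert i K, a' j = L j ∨ a' j = 0) ∧ f a ≤ f a' := by
        intro c hc0 hcL hc hfc
        refine ⟨Function.update a' i c, ?_, ?_, fun j hj => ?_, hfc⟩
        · exact le_update_iff.2 ⟨hc0, fun j _ => h0 j⟩
        · exact update_le_iff.2 ⟨hcL, fun j _ => h1 j⟩
        · rcases eq_or_ne j i with rfl | hji
          · simpa using hc
          · simpa [hji] using hK j (Finset.mem_of_mem_insert_of_ne hj hji)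
      rcases le_max_iff.1 (hle.trans (hf a' h0 h1 i)) with h | h
      · exact upd _ (hL i) le_rfl (Or.inl rfl) h
      · exact upd _ le_rfl (hL i) (Or.inr rfl) h
  obtain ⟨a', -, -, hK, hle⟩ := key Finset.univ
  refine ⟨Finset.univ.filter fun i => a' i = L i, hle.trans_eq (congrArg f (funext fun i => ?_))⟩
  rcases hK i (Finset.mem_univ i) with h | h <;> by_cases h' : a' i = L i <;> simp_all

/-- A point of a box is, in each coordinate, a convex combination of the two points obtained by
moving that coordinate to its endpoints. -/
theorem exists_update_combo {ι : Type*} [DecidableEq ι] {L a : ι → ℝ} (ha : 0 ≤ a) (haL : a ≤ L)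
    (i : ι) : ∃ t : ℝ, 0 ≤ t ∧ t ≤ 1 ∧
      a = t • Function.update a i (L i) + (1 - t) • Function.update a i 0 := by
  have h0 : 0 ≤ a i := ha i
  have h1 : a i ≤ L i := haL i
  refine ⟨a i / L i, div_nonneg h0 (h0.trans h1), div_le_one_of_le₀ h1 (h0.trans h1), ?_⟩
  funext j
  rcases eq_or_ne j i with rfl | hji
  · rcases eq_or_ne (L j) 0 with hL | hL
    · simp [hL, le_antisymm (hL ▸ h1) h0]
    · simp [hL]
  · simp [hji]
    ring

/-- A convex set containing `0` is stable under sub-convex combinations. -/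
theorem convex_sum_smul_mem {E ι : Type*} [AddCommGroup E] [Module ℝ E] [Fintype ι] {M : Set E}
    (hM : Convex ℝ M) (h0 : (0 : E) ∈ M) {w : ι → ℝ} (hw : 0 ≤ w) (hw1 : ∑ i, w i ≤ 1)
    {z : ι → E} (hz : ∀ i, z i ∈ M) : ∑ i, w i • z i ∈ M := by
  have := hM.sum_mem (t := Finset.univ) (w := fun o : Option ι => o.elim (1 - ∑ i, w i) w)
    (z := fun o : Option ι => o.elim 0 z)
    (by rintro (_ | i) -
        · simpa using hw1
        · exact hw i)
    (by simp [Fintype.sum_option])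
    (by rintro (_ | i) -
        · exact h0
        · exact hz i)
  simpa [Fintype.sum_option] using this

/-- The combination `∑ i j, a i * b j • u i j` of an array `u`. -/
def bilinSum {E ι κ : Type*} [AddCommGroup E] [Module ℝ E] [Fintype ι] [Fintype κ]
    (u : ι → κ → E) (a : ι → ℝ) (b : κ → ℝ) : E :=
  ∑ i, a i • ∑ j, b j • u i j

section bilinSum

variable {E ι κ : Type*} [AddCommGroup E] [Module ℝ E] [Fintype ι] [Fintype κ]

theorem bilinSum_combo_left (u : ι → κ → E) (s t : ℝ) (a a' : ι → ℝ) (b : κ → ℝ) :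
    bilinSum u (s • a + t • a') b = s • bilinSum u a b + t • bilinSum u a' b := by
  simp [bilinSum, add_smul, mul_smul, Finset.sum_add_distrib, Finset.smul_sum]

theorem bilinSum_combo_right (u : ι → κ → E) (s t : ℝ) (a : ι → ℝ) (b b' : κ → ℝ) :
    bilinSum u a (s • b + t • b') = s • bilinSum u a b + t • bilinSum u a b' := by
  simp only [bilinSum, Pi.add_apply, Pi.smul_apply, smul_eq_mul, add_smul, mul_smul,
    Finset.sum_add_distrib, Finset.smul_sum, smul_add]
  congr 1 <;> refine Finset.sum_congr rfl fun i _ => Finset.sum_congr rfl fun j _ => ?_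
  · rw [smul_comm (a i) s]
  · rw [smul_comm (a i) t]

theorem bilinSum_mem {M : Set E} (hM : Convex ℝ M) (h0 : (0 : E) ∈ M) {u : ι → κ → E}
    (hu : ∀ i j, u i j ∈ M) {a : ι → ℝ} {b : κ → ℝ} (ha : 0 ≤ a) (hb : 0 ≤ b)
    (ha1 : ∑ i, a i ≤ 1) (hb1 : ∑ j, b j ≤ 1) : bilinSum u a b ∈ M :=
  convex_sum_smul_mem hM h0 ha ha1 fun i => convex_sum_smul_mem hM h0 hb hb1 (hu i)

end bilinSum

/-- A quasi-convex distance between two bilinear combinations with coefficients in a box is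
bounded by its value at some vertex of the box. -/
theorem QuasiConvexOn.exists_vertex_bilinSum {Z ι κ : Type*} [MeasurableSpace Z]
    [Fintype ι] [Fintype κ] [DecidableEq ι] [DecidableEq κ]
    {M : Set (SignedMeasure Z)} (hM : Convex ℝ M) (h0 : (0 : SignedMeasure Z) ∈ M)
    {dm : SignedMeasure Z → SignedMeasure Z → ℝ} (hqc : QuasiConvexOn M dm)
    {u w : ι → κ → SignedMeasure Z} (hu : ∀ i j, u i j ∈ M) (hw : ∀ i j, w i j ∈ M)
    {L a : ι → ℝ} {R b : κ → ℝ} (hL1 : ∑ i, L i ≤ 1) (hR1 : ∑ j, R j ≤ 1)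
    (ha : 0 ≤ a) (haL : a ≤ L) (hb : 0 ≤ b) (hbR : b ≤ R) :
    ∃ (I : Finset ι) (J : Finset κ),
      dm (bilinSum u a b) (bilinSum w a b) ≤
        dm (bilinSum u (fun i => if i ∈ I then L i else 0) fun j => if j ∈ J then R j else 0)
          (bilinSum w (fun i => if i ∈ I then L i else 0) fun j => if j ∈ J then R j else 0) := by
  have hL : 0 ≤ L := ha.trans haL
  have hR : 0 ≤ R := hb.trans hbR
  have mem : ∀ {v : ι → κ → SignedMeasure Z}, (∀ i j, v i j ∈ M) → ∀ {a b}, 0 ≤ a → a ≤ L →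
      0 ≤ b → b ≤ R → bilinSum v a b ∈ M := fun hv _ _ ha haL hb hbR =>
    bilinSum_mem hM h0 hv ha hb ((Finset.sum_le_sum fun i _ => haL i).trans hL1)
      ((Finset.sum_le_sum fun j _ => hbR j).trans hR1)
  obtain ⟨I, hI⟩ := exists_vertex_ge (fun a => dm (bilinSum u a b) (bilinSum w a b)) L hL
    (fun a ha haL i => by
      obtain ⟨t, ht0, ht1, hat⟩ := exists_update_combo ha haL i
      have l0 : 0 ≤ Function.update a i (L i) := le_update_iff.2 ⟨hL i, fun j _ => ha j⟩
      have l1 : Function.update a i (L i) ≤ L := update_le_iff.2 ⟨le_rfl, fun j _ => haL j⟩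
      have z0 : 0 ≤ Function.update a i 0 := le_update_iff.2 ⟨le_rfl, fun j _ => ha j⟩
      have z1 : Function.update a i 0 ≤ L := update_le_iff.2 ⟨hL i, fun j _ => haL j⟩
      have := hqc _ (mem hu l0 l1 hb hbR) _ (mem hu z0 z1 hb hbR)
        _ (mem hw l0 l1 hb hbR) _ (mem hw z0 z1 hb hbR) t ht0 ht1
      rwa [← bilinSum_combo_left, ← bilinSum_combo_left, ← hat] at this) a ha haL
  have hI0 : (0 : ι → ℝ) ≤ fun i => if i ∈ I then L i else 0 := fun i => by
    dsimp only; split_ifs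
    exacts [hL i, le_rfl]
  have hIL : (fun i => if i ∈ I then L i else 0) ≤ L := fun i => by
    dsimp only; split_ifs
    exacts [le_rfl, hL i]
  obtain ⟨J, hJ⟩ := exists_vertex_ge
    (fun b => dm (bilinSum u (fun i => if i ∈ I then L i else 0) b)
      (bilinSum w (fun i => if i ∈ I then L i else 0) b)) R hR
    (fun b hb hbR j => by
      obtain ⟨t, ht0, ht1, hbt⟩ := exists_update_combo hb hbR j
      have l0 : 0 ≤ Function.update b j (R j) := le_update_iff.2 ⟨hR j, fun k _ => hb k⟩
      have l1 : Function.update b j (R j) ≤ R := update_le_iff.2 ⟨le_rfl, fun k _ => hbR k⟩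
      have z0 : 0 ≤ Function.update b j 0 := le_update_iff.2 ⟨le_rfl, fun k _ => hb k⟩
      have z1 : Function.update b j 0 ≤ R := update_le_iff.2 ⟨hR j, fun k _ => hbR k⟩
      have := hqc _ (mem hu hI0 hIL l0 l1) _ (mem hu hI0 hIL z0 z1)
        _ (mem hw hI0 hIL l0 l1) _ (mem hw hI0 hIL z0 z1) t ht0 ht1
      rwa [← bilinSum_combo_right, ← bilinSum_combo_right, ← hbt] at this) b hb hbR
  exact ⟨I, J, hI.trans hJ⟩

/-! ### Stepfunctions -/

namespace FinPartition

variable (P : FinPartition)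

theorem exists_mem (x : unitInterval) : ∃ i, x ∈ P.part i :=
  Set.mem_iUnion.1 (P.covers ▸ Set.mem_univ x)

/-- The index of the class containing a point. -/
def index (x : unitInterval) : Fin P.n := (P.exists_mem x).choose

theorem mem_part_index (x : unitInterval) : x ∈ P.part (P.index x) :=
  (P.exists_mem x).choose_spec

theorem index_eq_iff {x : unitInterval} {i : Fin P.n} : P.index x = i ↔ x ∈ P.part i := by
  refine ⟨fun h => h ▸ P.mem_part_index x, fun h => ?_⟩
  by_contra hne
  exact Set.disjoint_left.1 (P.disjoint _ _ hne) (P.mem_part_index x) h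

theorem preimage_index (i : Fin P.n) : P.index ⁻¹' {i} = P.part i :=
  Set.ext fun _ => P.index_eq_iff

theorem measurable_index : Measurable P.index :=
  measurable_to_countable' fun i => P.preimage_index i ▸ P.measurableSet i

theorem sum_volume_part : ∑ i, volume.real (P.part i) = 1 := by
  have h := measureReal_iUnion_fintype (μ := (volume : Measure unitInterval))
    (fun i j hij => P.disjoint i j hij) P.measurableSet
  rw [← h, P.covers]
  simp

theorem volume_part_inter_biUnion (I : Finset (Fin P.n)) (i : Fin P.n) :
    volume.real (P.part i ∩ ⋃ k ∈ I, P.part k) = if i ∈ I then volume.real (P.part i) else 0 := by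
  split_ifs with h
  · have hsub : P.part i ⊆ ⋃ k ∈ I, P.part k := fun x hx => Set.mem_iUnion₂.2 ⟨i, h, hx⟩
    rw [Set.inter_eq_left.2 hsub]
  · rw [Set.disjoint_iff_inter_eq_empty.1, measureReal_empty]
    refine Set.disjoint_iUnion₂_right.2 fun k hk => P.disjoint i k ?_
    rintro rfl
    exact h hk

/-- Every map constant on the rectangles of `P` factors through the index map. -/
theorem exists_factor {α : Type*} {U : Sq → α} {M : Set α} (hM : ∀ p, U p ∈ M)
    (hU : ∀ i j : Fin P.n, ∀ p ∈ P.part i ×ˢ P.part j, ∀ q ∈ P.part i ×ˢ P.part j, U p = U q) :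
    ∃ u : Fin P.n → Fin P.n → α, (∀ i j, u i j ∈ M) ∧
      U = fun p => u (P.index p.1) (P.index p.2) := by
  classical
  let rep : Fin P.n → unitInterval := fun i => if h : (P.part i).Nonempty then h.some else 0
  have hrep : ∀ x, rep (P.index x) ∈ P.part (P.index x) := fun x => by
    have h : (P.part (P.index x)).Nonempty := ⟨x, P.mem_part_index x⟩
    simp only [rep, dif_pos h]
    exact h.some_mem
  exact ⟨fun i j => U (rep i, rep j), fun _ _ => hM _, funext fun p =>
    hU _ _ p ⟨P.mem_part_index _, P.mem_part_index _⟩ _ ⟨hrep _, hrep _⟩⟩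

theorem bind_restrict_prod_apply {Z : Type*} [MeasurableSpace Z] (ν : Fin P.n → Fin P.n → Measure Z)
    (S T : Set unitInterval)
    {A : Set Z} (hA : MeasurableSet A) :
    ((volume : Measure Sq).restrict (S ×ˢ T)).bind
        (fun p => ν (P.index p.1) (P.index p.2)) A =
      ∑ i, ∑ j, ν i j A * (volume (P.part i ∩ S) * volume (P.part j ∩ T)) := by
  have hidx : Measurable fun p : Sq => (P.index p.1, P.index p.2) :=
    (P.measurable_index.comp measurable_fst).prodMk (P.measurable_index.comp measurable_snd)
  have hν : Measurable fun q : Fin P.n × Fin P.n => ν q.1 q.2 := measurable_of_finite _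
  rw [Measure.bind_apply (f := fun p : Sq => ν (P.index p.1) (P.index p.2)) hA
      (hν.comp hidx).aemeasurable,
    ← lintegral_map (f := fun q : Fin P.n × Fin P.n => ν q.1 q.2 A)
      (measurable_of_finite _) hidx, lintegral_fintype, Fintype.sum_prod_type]
  refine Finset.sum_congr rfl fun i _ => Finset.sum_congr rfl fun j _ => ?_
  have hpre : (fun p : Sq => (P.index p.1, P.index p.2)) ⁻¹' {(i, j)} =
      P.part i ×ˢ P.part j := by
    ext p
    simp [P.index_eq_iff]
  rw [Measure.map_apply hidx (measurableSet_singleton _), hpre,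
    Measure.restrict_apply ((P.measurableSet i).prod (P.measurableSet j)), Set.prod_inter_prod,
    Measure.volume_eq_prod, Measure.prod_prod]

theorem toSigned_bind_restrict_prod_apply {Z : Type*} [MeasurableSpace Z]
    (ν : Fin P.n → Fin P.n → Measure Z) [∀ i j, IsFiniteMeasure (ν i j)]
    (S T : Set unitInterval)
    {A : Set Z} (hA : MeasurableSet A) :
    toSigned (((volume : Measure Sq).restrict (S ×ˢ T)).bind
        (fun p => ν (P.index p.1) (P.index p.2))) A =
      ∑ i, ∑ j, (ν i j).real A * (volume.real (P.part i ∩ S) * volume.real (P.part j ∩ T)) := by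
  have hfin : ∀ B, ∀ i j,
      ν i j B * (volume (P.part i ∩ S) * volume (P.part j ∩ T)) ≠ ⊤ := fun B i j => by
    finiteness
  have : IsFiniteMeasure (((volume : Measure Sq).restrict (S ×ˢ T)).bind
        (fun p => ν (P.index p.1) (P.index p.2))) := ⟨by
    rw [P.bind_restrict_prod_apply ν S T MeasurableSet.univ]
    exact ENNReal.sum_lt_top.2 fun i _ => ENNReal.sum_lt_top.2 fun j _ =>
      (hfin _ i j).lt_top⟩
  rw [toSigned, dif_pos this, Measure.toSignedMeasure_apply_measurable hA, measureReal_def,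
    P.bind_restrict_prod_apply ν S T hA,
    ENNReal.toReal_sum fun i _ => ENNReal.sum_ne_top.2 fun j _ => hfin A i j]
  refine Finset.sum_congr rfl fun i _ => ?_
  rw [ENNReal.toReal_sum fun j _ => hfin A i j]
  simp [measureReal_def]

/-- The integral of a stepfunction over a measurable rectangle. -/
theorem skernelInt_step {Z : Type*} [MeasurableSpace Z] (u : Fin P.n → Fin P.n → SignedMeasure Z)
    (S T : Set unitInterval) :
    skernelInt (fun p => u (P.index p.1) (P.index p.2)) (S ×ˢ T) =
      bilinSum u (fun i => volume.real (P.part i ∩ S)) fun j => volume.real (P.part j ∩ T) := by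
  ext A hA
  have hu : ∀ i j, u i j A = (u i j).toJordanDecomposition.posPart.real A -
      (u i j).toJordanDecomposition.negPart.real A := fun i j => by
    conv_lhs => rw [← (u i j).toSignedMeasure_toJordanDecomposition]
    exact Measure.toSignedMeasure_sub_apply hA
  rw [skernelInt, _root_.sub_apply,
    P.toSigned_bind_restrict_prod_apply
      (fun i j => (u i j).toJordanDecomposition.posPart) S T hA,
    P.toSigned_bind_restrict_prod_apply
      (fun i j => (u i j).toJordanDecomposition.negPart) S T hA]
  simp only [bilinSum, _root_.sum_apply, _root_.smul_apply, smul_eq_mul, hu, Finset.mul_sum, ← Finset.sum_sub_distrib]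
  refine Finset.sum_congr rfl fun i _ => Finset.sum_congr rfl fun j _ => ?_
  ring

end FinPartition

/-- **Combinatorial optimization of the cut distance for stepfunctions.**
Let `d_m` be a quasi-convex distance on a convex subset `ℳ` of `ℳ±(Z)` containing the
zero measure, and let `U, W` be `ℳ`-valued stepfunction kernels adapted to the same
finite measurable partition `𝒫` of `[0,1]`.  Then there exist sets `S, T ∈ σ(𝒫)`
(finite unions of classes of `𝒫`, encoded by index sets `I, J`) such that
`d_{□,m}(U, W) = d_m(U(S×T;·), W(S×T;·))`; in particular the supremum in the
definition of `d_{□,m}(U, W)` is attained. -/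
theorem cut_distance_combinatorial_for_stepfunctions
    {Z : Type*} [MeasurableSpace Z] [TopologicalSpace Z] [PolishSpace Z] [BorelSpace Z]
    (M : Set (SignedMeasure Z)) (hMconv : Convex ℝ M) (hM0 : (0 : SignedMeasure Z) ∈ M)
    (dm : SignedMeasure Z → SignedMeasure Z → ℝ)
    (hdist : IsDistOnSet M dm) (hqc : QuasiConvexOn M dm)
    (P : FinPartition) (U W : Sq → SignedMeasure Z)
    (hU : IsSignedKernel U) (hW : IsSignedKernel W)
    (hUM : ∀ p, U p ∈ M) (hWM : ∀ p, W p ∈ M)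
    (hUstep : ∀ i j : Fin P.n, ∀ p ∈ P.part i ×ˢ P.part j, ∀ q ∈ P.part i ×ˢ P.part j,
      U p = U q)
    (hWstep : ∀ i j : Fin P.n, ∀ p ∈ P.part i ×ˢ P.part j, ∀ q ∈ P.part i ×ˢ P.part j,
      W p = W q) :
    ∃ I J : Finset (Fin P.n),
      cutDistS dm U W =
        dm (skernelInt U ((⋃ i ∈ I, P.part i) ×ˢ (⋃ j ∈ J, P.part j)))
          (skernelInt W ((⋃ i ∈ I, P.part i) ×ˢ (⋃ j ∈ J, P.part j))) := by
  classical
  obtain ⟨u, huM, rfl⟩ := P.exists_factor hUM hUstep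
  obtain ⟨w, hwM, rfl⟩ := P.exists_factor hWM hWstep
  set L : Fin P.n → ℝ := fun i => volume.real (P.part i)
  let g : Finset (Fin P.n) × Finset (Fin P.n) → ℝ := fun q =>
    dm (bilinSum u (fun i => if i ∈ q.1 then L i else 0) fun j => if j ∈ q.2 then L j else 0)
      (bilinSum w (fun i => if i ∈ q.1 then L i else 0) fun j => if j ∈ q.2 then L j else 0)
  have hmeas : ∀ I : Finset (Fin P.n), MeasurableSet (⋃ i ∈ I, P.part i) := fun I =>
    I.measurableSet_biUnion fun i _ => P.measurableSet i
  have hg : ∀ I J : Finset (Fin P.n),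
      dm (skernelInt (fun p => u (P.index p.1) (P.index p.2))
            ((⋃ i ∈ I, P.part i) ×ˢ (⋃ j ∈ J, P.part j)))
          (skernelInt (fun p => w (P.index p.1) (P.index p.2))
            ((⋃ i ∈ I, P.part i) ×ˢ (⋃ j ∈ J, P.part j))) = g (I, J) := fun I J => by
    simp only [P.skernelInt_step, P.volume_part_inter_biUnion, g, L]
  obtain ⟨⟨I, J⟩, hmax⟩ := Finite.exists_max g
  refine ⟨I, J, ?_⟩
  have hle : ∀ ST : {p : Set unitInterval × Set unitInterval //
      MeasurableSet p.1 ∧ MeasurableSet p.2},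
      dm (skernelInt (fun p => u (P.index p.1) (P.index p.2)) (ST.val.1 ×ˢ ST.val.2))
        (skernelInt (fun p => w (P.index p.1) (P.index p.2)) (ST.val.1 ×ˢ ST.val.2)) ≤
      g (I, J) := by
    rintro ⟨⟨S, T⟩, -⟩
    have h0 : ∀ S : Set unitInterval, (0 : Fin P.n → ℝ) ≤ fun i => volume.real (P.part i ∩ S) :=
      fun S i => measureReal_nonneg
    have h1 : ∀ S : Set unitInterval, (fun i => volume.real (P.part i ∩ S)) ≤ L :=
      fun S i => measureReal_mono Set.inter_subset_left
    obtain ⟨I', J', h⟩ := hqc.exists_vertex_bilinSum hMconv hM0 huM hwM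
      P.sum_volume_part.le P.sum_volume_part.le (h0 S) (h1 S) (h0 T) (h1 T)
    rw [P.skernelInt_step, P.skernelInt_step]
    exact h.trans (hmax (I', J'))
  have : Nonempty {p : Set unitInterval × Set unitInterval //
      MeasurableSet p.1 ∧ MeasurableSet p.2} := ⟨⟨(∅, ∅), .empty, .empty⟩⟩
  rw [hg]
  refine le_antisymm (ciSup_le hle) ?_
  rw [← hg]
  exact le_ciSup ⟨g (I, J), Set.forall_mem_range.2 hle⟩
    ⟨(⋃ i ∈ I, P.part i, ⋃ j ∈ J, P.part j), hmeas I, hmeas J⟩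

end PG
end
end
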